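/- Let T be a tree with exactly two vertices of degree at least 3. If F is any graph with X_F = X_T, then F is isomorphic to T. -/

import Mathlib

open SimpleGraph

/-- Proper coloring for an edge set over `Sym2 V` (loops allowed): adjacent (or equal, for a
loop) endpoints must receive different colors. -/
def ProperCol {V : Type*} (E : Set (Sym2 V)) (k : V -> Nat) : Prop :=
  forall u v : V, s(u, v) ∈ E -> k u ≠ k v

/-- Weighted chromatic symmetric function `X_{(G,w)}` as a formal power series in the
variables `x_0, x_1, …` : the coefficient of a monomial `d` is the number of proper
colorings whose total weight in color `i` is `d i` for every `i`. -/
noncomputable def csfW {V : Type*} (E : Set (Sym2 V)) (w : V -> Nat) : MvPowerSeries Nat Int :=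
  fun d => (Nat.card {k : V -> Nat |
    ProperCol E k ∧ forall i : Nat, (∑ᶠ v ∈ {v : V | k v = i}, w v) = d i} : Int)

/-- Chromatic symmetric function `X_G` of a simple graph. -/
noncomputable def csf {V : Type*} (G : SimpleGraph V) : MvPowerSeries Nat Int :=
  csfW G.edgeSet (fun _ => 1)

/-- Degree of a vertex. -/
noncomputable def deg {V : Type*} (G : SimpleGraph V) (v : V) : Nat :=
  Nat.card {u : V | G.Adj v u}

section Rooted

open Finset
open scoped Classical

/-- The number of ordered pairs `(x, y) ∈ A × B` of adjacent vertices. -/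
noncomputable def arcs {V : Type*} (G : SimpleGraph V) (A B : Finset V) : ℕ :=
  #{p ∈ A ×ˢ B | G.Adj p.1 p.2}

/-- A parent function `par` with root `r` and depth function `dep` describing the graph `G`. -/
structure IsRooting {V : Type*} (G : SimpleGraph V) (par : V → Option V) (dep : V → ℕ) (r : V) :
    Prop where
  adj_iff : ∀ x y, G.Adj x y ↔ par x = some y ∨ par y = some x
  dep_eq : ∀ x y, par x = some y → dep x = dep y + 1
  root_iff : ∀ x, par x = none ↔ x = r
  dep_root : dep r = 0

theorem exists_isRooting {V : Type*} {G : SimpleGraph V} (hG : G.IsTree) (r : V) :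
    ∃ par dep, IsRooting G par dep r := by
  have ex : ∀ x, x ≠ r → ∃ y, G.Adj x y ∧ G.dist r x = G.dist r y + 1 := by
    intro x hx
    obtain ⟨p, hp, hl⟩ := (hG.connected r x).exists_path_of_dist
    have hnil : ¬ p.Nil := fun h => hx h.eq.symm
    have hadj := p.adj_penultimate hnil
    refine ⟨p.penultimate, hadj.symm, ?_⟩
    rcases hG.dist_eq_dist_add_one_of_adj r hadj with h | h
    · have h1 : G.dist r p.penultimate ≤ p.dropLast.length := dist_le _
      have h2 : p.dropLast.length ≤ p.length := by simp
      omega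
    · exact h
  have uniq : ∀ x y z, G.Adj x y → G.dist r x = G.dist r y + 1 → G.Adj x z →
      G.dist r x = G.dist r z + 1 → y = z := by
    intro x y z hy hy' hz hz'
    obtain ⟨p, hp, hl⟩ := (hG.connected r x).exists_path_of_dist
    have key : ∀ w, G.Adj x w → G.dist r x = G.dist r w + 1 → w = p.penultimate := by
      intro w hw hw'
      apply hG.isAcyclic.eq_penultimate_of_adj_end hp hw
      by_contra hns
      obtain ⟨q, hq, hql⟩ := (hG.connected r w).exists_path_of_dist
      have hx : x ∈ q.support :=
        hG.isAcyclic.mem_support_of_ne_mem_support_of_adj_of_isPath hq hp hw.symm hns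
      have := hG.isAcyclic.path_concat hp hq hw hx
      rw [this, Walk.length_concat] at hql
      omega
    rw [key y hy hy', key z hz hz']
  choose! f hf using ex
  refine ⟨fun x => if x = r then none else some (f x), fun x => G.dist r x, ?_, ?_, ?_,
    dist_self⟩
  · intro x y
    have aux : ∀ x y, G.Adj x y → G.dist r x = G.dist r y + 1 →
        (if x = r then none else some (f x)) = some y := by
      intro x y h h'
      have hx : x ≠ r := by rintro rfl; simp at h'
      rw [if_neg hx, uniq x y (f x) h h' (hf x hx).1 (hf x hx).2]
    have aux' : ∀ x y, (if x = r then none else some (f x)) = some y → G.Adj x y := by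
      intro x y h
      split_ifs at h with hx
      simp only [Option.some.injEq] at h
      exact h ▸ (hf x hx).1
    constructor
    · intro h
      rcases hG.dist_eq_dist_add_one_of_adj r h with h' | h'
      · exact Or.inl (aux x y h h')
      · exact Or.inr (aux y x h.symm h')
    · rintro (h | h)
      · exact aux' x y h
      · exact (aux' y x h).symm
  · intro x y h
    split_ifs at h with hx
    simp only [Option.some.injEq] at h
    exact h ▸ (hf x hx).2
  · intro x
    simp

namespace IsRooting

variable {V : Type*} {G : SimpleGraph V} {par : V → Option V} {dep : V → ℕ} {r : V}

theorem exists_iso (h : IsRooting G par dep r) {W : Type*} {H : SimpleGraph W}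
    {par' : W → Option W} {dep' : W → ℕ} {r' : W} (h' : IsRooting H par' dep' r') (e : V ≃ W)
    (he : ∀ x, par' (e x) = (par x).map e) : ∃ f : G ≃g H, ∀ x, f x = e x := by
  have : ∀ x y, par' (e x) = some (e y) ↔ par x = some y := by
    intro x y
    rw [he, Option.map_eq_some_iff]
    simp
  exact ⟨⟨e, fun {x y} => by rw [h.adj_iff, h'.adj_iff, this, this]⟩, fun _ => rfl⟩

theorem arcs_eq (h : IsRooting G par dep r) (A B : Finset V) :
    arcs G A B = #{x ∈ A | ∃ p ∈ B, par x = some p} + #{x ∈ B | ∃ p ∈ A, par x = some p} := by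
  have e : {p ∈ A ×ˢ B | G.Adj p.1 p.2} =
      {p ∈ A ×ˢ B | par p.1 = some p.2} ∪ {p ∈ A ×ˢ B | par p.2 = some p.1} := by
    ext p
    simp only [mem_filter, mem_union, h.adj_iff]
    tauto
  rw [arcs, e, card_union_of_disjoint]
  · congr 1
    · refine card_nbij (fun p => p.1) ?_ ?_ ?_
      · intro p hp
        simp only [coe_filter, mem_product, Set.mem_ofPred_eq] at hp ⊢
        exact ⟨hp.1.1, p.2, hp.1.2, hp.2⟩
      · rintro ⟨x, y⟩ hp ⟨x', y'⟩ hp' rfl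
        simp only [coe_filter, mem_product, Set.mem_ofPred_eq] at hp hp'
        have := hp.2.symm.trans hp'.2
        simpa using this
      · rintro x hx
        simp only [coe_filter, Set.mem_ofPred_eq] at hx
        obtain ⟨hx, p, hp, e⟩ := hx
        exact ⟨(x, p), by simp [hx, hp, e], rfl⟩
    · refine card_nbij (fun p => p.2) ?_ ?_ ?_
      · intro p hp
        simp only [coe_filter, mem_product, Set.mem_ofPred_eq] at hp ⊢
        exact ⟨hp.1.2, p.1, hp.1.1, hp.2⟩
      · rintro ⟨x, y⟩ hp ⟨x', y'⟩ hp' rfl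
        simp only [coe_filter, mem_product, Set.mem_ofPred_eq] at hp hp'
        have := hp.2.symm.trans hp'.2
        simpa using this
      · rintro x hx
        simp only [coe_filter, Set.mem_ofPred_eq] at hx
        obtain ⟨hx, p, hp, e⟩ := hx
        exact ⟨(p, x), by simp [hx, hp, e], rfl⟩
  · rw [Finset.disjoint_left]
    intro p hp hp'
    simp only [mem_filter] at hp hp'
    have h1 := h.dep_eq _ _ hp.2
    have h2 := h.dep_eq _ _ hp'.2
    omega

theorem inner_lt_card (h : IsRooting G par dep r) {A : Finset V} (hA : A.Nonempty) :
    #{x ∈ A | ∃ p ∈ A, par x = some p} < #A := by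
  obtain ⟨x, hx, hmin⟩ := exists_min_image A dep hA
  apply card_lt_card
  rw [filter_ssubset]
  refine ⟨x, hx, ?_⟩
  rintro ⟨p, hp, e⟩
  have := h.dep_eq _ _ e
  have := hmin p hp
  omega

variable [Fintype V]

theorem card_nonroot (h : IsRooting G par dep r) :
    #{x : V | ∃ p, par x = some p} + 1 = Fintype.card V := by
  have : ({x : V | ∃ p, par x = some p} : Finset V) = univ.erase r := by
    ext x
    simp only [mem_filter, mem_univ, true_and, mem_erase, and_true, ne_eq, ← h.root_iff,
      ← Option.ne_none_iff_exists']
  rw [this, card_erase_of_mem (mem_univ r), card_univ]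
  have : 0 < Fintype.card V := Fintype.card_pos_iff.2 ⟨r⟩
  omega

theorem inner_add_inner_compl_add_arcs (h : IsRooting G par dep r) (A : Finset V) :
    #{x ∈ A | ∃ p ∈ A, par x = some p} + #{x ∈ Aᶜ | ∃ p ∈ Aᶜ, par x = some p} + arcs G A Aᶜ + 1
      = Fintype.card V := by
  rw [h.arcs_eq, ← h.card_nonroot]
  have e1 : #{x : V | ∃ p, par x = some p} =
      #{x ∈ A | ∃ p, par x = some p} + #{x ∈ Aᶜ | ∃ p, par x = some p} := by
    rw [← card_union_of_disjoint, ← filter_union, union_compl]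
    exact disjoint_filter_filter disjoint_compl_right
  have e2 : ∀ B : Finset V, #{x ∈ B | ∃ p, par x = some p} =
      #{x ∈ B | ∃ p ∈ A, par x = some p} + #{x ∈ B | ∃ p ∈ Aᶜ, par x = some p} := by
    intro B
    rw [← card_union_of_disjoint, ← filter_or]
    · congr 1
      apply filter_congr
      intro x _
      constructor
      · rintro ⟨p, hp⟩
        by_cases hA : p ∈ A
        · exact Or.inl ⟨p, hA, hp⟩
        · exact Or.inr ⟨p, by simpa using hA, hp⟩
      · rintro (⟨p, -, hp⟩ | ⟨p, -, hp⟩) <;> exact ⟨p, hp⟩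
    · rw [Finset.disjoint_left]
      intro x hx hx'
      simp only [mem_filter, mem_compl] at hx hx'
      obtain ⟨-, p, hp, e⟩ := hx
      obtain ⟨-, q, hq, e'⟩ := hx'
      rw [e] at e'
      simp only [Option.some.injEq] at e'
      exact hq (e' ▸ hp)
  rw [e1, e2 A, e2 Aᶜ]
  omega

theorem card_colorings_aux (h : IsRooting G par dep r) (L : Bool → Finset ℕ)
    (hL : Disjoint (L true) (L false)) (g : V → Bool) (S : Finset V)
    (hS : ∀ x ∈ S, ∀ p, par x = some p → p ∈ S) :
    #{f ∈ Fintype.piFinset (fun x => if x ∈ S then L (g x) else {0}) |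
      ∀ x ∈ S, ∀ p, par x = some p → f x ≠ f p} =
    ∏ x ∈ S, (#(L (g x)) - if ∃ p, par x = some p ∧ g p = g x then 1 else 0) := by
  induction hn : #S generalizing S with
  | zero =>
    rw [card_eq_zero] at hn
    subst hn
    simp
  | succ n ih =>
    have hne : S.Nonempty := by rw [← card_pos]; omega
    obtain ⟨x, hx, hmax⟩ := exists_max_image S dep hne
    have hcl : ∀ y ∈ S.erase x, ∀ p, par y = some p → p ∈ S.erase x := by
      intro y hy p hp
      refine mem_erase.2 ⟨?_, hS y (mem_of_mem_erase hy) p hp⟩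
      rintro rfl
      have := h.dep_eq _ _ hp
      have := hmax y (mem_of_mem_erase hy)
      omega
    rw [← mul_prod_erase S _ hx, ← ih _ hcl (by rw [card_erase_of_mem hx]; omega)]
    rw [card_eq_sum_card_fiberwise (f := fun f => Function.update f x 0)
      (t := {f ∈ Fintype.piFinset (fun y => if y ∈ S.erase x then L (g y) else {0}) |
        ∀ y ∈ S.erase x, ∀ p, par y = some p → f y ≠ f p})]
    · rw [sum_const_nat (m := #(L (g x)) - if ∃ p, par x = some p ∧ g p = g x then 1 else 0),
        mul_comm]
      intro f hf
      simp only [mem_filter, Fintype.mem_piFinset] at hf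
      obtain ⟨hf1, hf2⟩ := hf
      have hfx : f x = 0 := by simpa using hf1 x
      have : #{c ∈ L (g x) | ∀ p, par x = some p → c ≠ f p} =
          #(L (g x)) - if ∃ p, par x = some p ∧ g p = g x then 1 else 0 := by
        split_ifs with hp
        · obtain ⟨p, hp, hg⟩ := hp
          have hpx : p ≠ x := by
            rintro rfl
            have := h.dep_eq _ _ hp
            omega
          have hpL := hf1 p
          rw [if_pos (mem_erase.2 ⟨hpx, hS x hx p hp⟩), hg] at hpL
          rw [← card_erase_of_mem hpL]
          congr 1
          ext c
          simp only [hp, mem_filter, mem_erase, Option.some.injEq, forall_eq']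
          tauto
        · rw [Nat.sub_zero]
          congr 1
          apply filter_true_of_mem
          rintro c hc p hpar rfl
          apply hp
          refine ⟨p, hpar, ?_⟩
          have hpx : p ≠ x := by
            rintro rfl
            have := h.dep_eq _ _ hpar
            omega
          have hpL := hf1 p
          rw [if_pos (mem_erase.2 ⟨hpx, hS x hx p hpar⟩)] at hpL
          rw [Finset.disjoint_left] at hL
          cases h1 : g p <;> cases h2 : g x <;> rw [h1] at hpL <;> rw [h2] at hc <;> try rfl
          · exact (hL hc hpL).elim
          · exact (hL hpL hc).elim
      rw [← this]
      refine card_nbij' (fun f => f x) (fun c => Function.update f x c) ?_ ?_ ?_ ?_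
      · intro k hk
        simp only [coe_filter, mem_filter, Fintype.mem_piFinset, Set.mem_ofPred_eq] at hk ⊢
        obtain ⟨⟨hk1, hk2⟩, rfl⟩ := hk
        refine ⟨by simpa [hx] using hk1 x, ?_⟩
        intro p hp
        have hpx : p ≠ x := by
          rintro rfl
          have := h.dep_eq _ _ hp
          omega
        rw [Function.update_of_ne hpx]
        exact hk2 x hx p hp
      · intro c hc
        simp only [coe_filter, mem_filter, Fintype.mem_piFinset, Set.mem_ofPred_eq] at hc ⊢
        refine ⟨⟨?_, ?_⟩, ?_⟩
        · intro y
          by_cases hy : y = x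
          · subst hy
            simp [hx, hc.1]
          · rw [Function.update_of_ne hy]
            simpa [hy] using hf1 y
        · intro y hy p hp
          have hpx : p ≠ x := by
            rintro rfl
            have := h.dep_eq _ _ hp
            have := hmax y hy
            omega
          rw [Function.update_of_ne hpx]
          by_cases hyx : y = x
          · subst hyx
            rw [Function.update_self]
            exact hc.2 p hp
          · rw [Function.update_of_ne hyx]
            exact hf2 y (mem_erase.2 ⟨hyx, hy⟩) p hp
        · rw [Function.update_idem, ← hfx, Function.update_eq_self]
      · intro k hk
        simp only [coe_filter, mem_filter, Set.mem_ofPred_eq] at hk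
        obtain ⟨-, rfl⟩ := hk
        simp
      · intro c hc
        simp
    · intro f hf
      simp only [coe_filter, Fintype.mem_piFinset, Set.mem_ofPred_eq] at hf ⊢
      refine ⟨?_, ?_⟩
      · intro y
        by_cases hy : y = x
        · subst hy; simp
        · rw [Function.update_of_ne hy]
          simpa [hy] using hf.1 y
      · intro y hy p hp
        have hpx := ne_of_mem_erase (hcl y hy p hp)
        rw [Function.update_of_ne hpx, Function.update_of_ne (ne_of_mem_erase hy)]
        exact hf.2 y (mem_of_mem_erase hy) p hp

theorem card_colorings (h : IsRooting G par dep r) (L : Bool → Finset ℕ)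
    (hL : Disjoint (L true) (L false)) (g : V → Bool) :
    #{f ∈ Fintype.piFinset (fun x => L (g x)) | ∀ x y, G.Adj x y → f x ≠ f y} =
    ∏ x, (#(L (g x)) - if ∃ p, par x = some p ∧ g p = g x then 1 else 0) := by
  rw [← h.card_colorings_aux L hL g univ (by simp)]
  simp only [mem_univ, if_true]
  congr 1
  apply filter_congr
  intro f _
  simp only [h.adj_iff, true_imp_iff]
  constructor
  · intro H x p hp
    exact H x p (Or.inl hp)
  · rintro H x y (hp | hp)
    · exact H x y hp
    · exact (H y x hp).symm

end IsRooting

end Rooted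

section Csf

open Finset
open scoped Classical

variable {V W : Type*} [Fintype V] [Fintype W]

/-- The exponent vector of the monomial of a coloring. -/
noncomputable def colorType (f : V → ℕ) : ℕ →₀ ℕ := ∑ v, Finsupp.single (f v) 1

theorem colorType_apply (f : V → ℕ) (i : ℕ) : colorType f i = #{v | f v = i} := by
  rw [colorType, Finsupp.finsetSum_apply, card_filter]
  exact sum_congr rfl fun v _ => by rw [Finsupp.single_apply]

theorem csf_apply (G : SimpleGraph V) (d : ℕ →₀ ℕ) :
    csf G d = (Nat.card {f : {f : V → ℕ // ∀ x y, G.Adj x y → f x ≠ f y} //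
      colorType f.1 = d} : ℤ) := by
  rw [csf, csfW, Nat.cast_inj]
  have key : ∀ f : V → ℕ, (∀ i, ∑ᶠ v ∈ {v : V | f v = i}, 1 = d i) ↔ colorType f = d := by
    intro f
    rw [DFunLike.ext_iff]
    refine forall_congr' fun i => ?_
    rw [colorType_apply, finsum_mem_eq_finite_toFinset_sum _ (Set.toFinite _), sum_const,
      smul_eq_mul, mul_one]
    have : (Set.toFinite {v | f v = i}).toFinset = ({v | f v = i} : Finset V) := by ext; simp
    rw [this]
  refine Nat.card_congr ⟨fun f => ⟨⟨f.1, ?_⟩, ?_⟩, fun f => ⟨f.1.1, ?_, ?_⟩, ?_, ?_⟩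
  · exact fun x y hxy => f.2.1 x y hxy
  · exact (key _).1 f.2.2
  · exact fun x y hxy => f.1.2 x y hxy
  · exact (key _).2 f.2
  · intro f; rfl
  · intro f; rfl

theorem finite_colorType (G : SimpleGraph V) (d : ℕ →₀ ℕ) :
    Finite {f : {f : V → ℕ // ∀ x y, G.Adj x y → f x ≠ f y} // colorType f.1 = d} := by
  refine Finite.of_injective (β := V → d.support) (fun f x => ⟨f.1.1 x, ?_⟩) ?_
  · obtain ⟨f, rfl⟩ := f
    rw [Finsupp.mem_support_iff, colorType_apply, ← Nat.pos_iff_ne_zero, card_pos]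
    exact ⟨x, by simp⟩
  · intro f g hfg
    ext x
    simpa using congrFun hfg x

theorem exists_colorings_equiv {F : SimpleGraph W} {G : SimpleGraph V} (h : csf F = csf G) :
    ∃ Φ : {f : W → ℕ // ∀ x y, F.Adj x y → f x ≠ f y} ≃
        {f : V → ℕ // ∀ x y, G.Adj x y → f x ≠ f y},
      ∀ f i, #{v | (Φ f).1 v = i} = #{w | f.1 w = i} := by
  have e : ∀ d : ℕ →₀ ℕ, Nonempty
      ({f : {f : W → ℕ // ∀ x y, F.Adj x y → f x ≠ f y} // colorType f.1 = d} ≃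
        {f : {f : V → ℕ // ∀ x y, G.Adj x y → f x ≠ f y} // colorType f.1 = d}) := by
    intro d
    have := finite_colorType F d
    have := finite_colorType G d
    have hd : csf F d = csf G d := congrFun h d
    rw [csf_apply, csf_apply, Nat.cast_inj] at hd
    exact Finite.card_eq.1 hd
  refine ⟨(Equiv.sigmaFiberEquiv fun f : {f : W → ℕ // ∀ x y, F.Adj x y → f x ≠ f y} =>
      colorType f.1).symm.trans
    ((Equiv.sigmaCongrRight fun d => (e d).some).trans
      (Equiv.sigmaFiberEquiv fun f : {f : V → ℕ // ∀ x y, G.Adj x y → f x ≠ f y} =>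
        colorType f.1)), fun f i => ?_⟩
  rw [← colorType_apply, ← colorType_apply]
  exact DFunLike.congr_fun ((e (colorType f.1)).some ⟨f, rfl⟩).2 i

theorem forall_lt_iff_card (f : V → ℕ) (m : ℕ) :
    (∀ v, f v < m) ↔ ∀ i, m ≤ i → #{v | f v = i} = 0 := by
  simp only [card_eq_zero, filter_eq_empty_iff, mem_univ, true_imp_iff]
  constructor
  · rintro h i hi v rfl
    exact (h v).not_ge hi
  · intro h v
    by_contra hv
    exact h (f v) (not_lt.1 hv) rfl

theorem card_le_eq_sum_card (f : V → ℕ) (q t : ℕ) (h : ∀ v, f v < q + t) :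
    #{v | q ≤ f v} = ∑ i ∈ Ico q (q + t), #{v | f v = i} := by
  rw [card_eq_sum_card_fiberwise (f := f) (t := Ico q (q + t))]
  · refine sum_congr rfl fun i hi => ?_
    rw [filter_filter]
    congr 1
    apply filter_congr
    intro v _
    rw [mem_Ico] at hi
    constructor
    · exact fun h => h.2
    · rintro rfl
      exact ⟨hi.1, rfl⟩
  · intro v hv
    simp only [coe_filter, mem_univ, true_and, Set.mem_ofPred_eq] at hv
    simpa using ⟨hv, h v⟩

/-- The number of proper colorings with colors `< q + t`, exactly `k` vertices having color `≥ q`,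
is determined by the chromatic symmetric function. -/
theorem card_two_block_colorings_eq {F : SimpleGraph W} {G : SimpleGraph V} (h : csf F = csf G)
    (q t k : ℕ) :
    #{f ∈ Fintype.piFinset (fun _ : W => range (q + t)) |
        (∀ x y, F.Adj x y → f x ≠ f y) ∧ #{w | q ≤ f w} = k} =
      #{f ∈ Fintype.piFinset (fun _ : V => range (q + t)) |
        (∀ x y, G.Adj x y → f x ≠ f y) ∧ #{v | q ≤ f v} = k} := by
  obtain ⟨Φ, hΦ⟩ := exists_colorings_equiv h
  have key : ∀ f, ((∀ w, f.1 w < q + t) ∧ #{w | q ≤ f.1 w} = k) ↔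
      ((∀ v, (Φ f).1 v < q + t) ∧ #{v | q ≤ (Φ f).1 v} = k) := by
    intro f
    have e : (∀ w, f.1 w < q + t) ↔ ∀ v, (Φ f).1 v < q + t := by
      simp only [forall_lt_iff_card, hΦ]
    rw [← e]
    refine and_congr_right fun hf => ?_
    rw [card_le_eq_sum_card _ q t hf, card_le_eq_sum_card _ q t (e.1 hf)]
    simp only [hΦ]
  refine card_bij (fun f hf => (Φ ⟨f, (mem_filter.1 hf).2.1⟩).1) ?_ ?_ ?_
  · intro f hf
    have hk := key ⟨f, (mem_filter.1 hf).2.1⟩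
    simp only [mem_filter, Fintype.mem_piFinset, mem_range] at hf ⊢
    obtain ⟨h1, h2⟩ := hk.1 ⟨hf.1, hf.2.2⟩
    exact ⟨h1, (Φ _).2, h2⟩
  · intro f hf g hg hfg
    simpa using Φ.injective (Subtype.ext hfg)
  · intro g hg
    simp only [mem_filter, Fintype.mem_piFinset, mem_range] at hg
    have hk := key (Φ.symm ⟨g, hg.2.1⟩)
    rw [Equiv.apply_symm_apply] at hk
    obtain ⟨h1, h2⟩ := hk.2 ⟨hg.1, hg.2.2⟩
    refine ⟨(Φ.symm ⟨g, hg.2.1⟩).1, ?_, ?_⟩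
    · simp only [mem_filter, Fintype.mem_piFinset, mem_range]
      exact ⟨h1, (Φ.symm _).2, h2⟩
    · simp

theorem card_eq_of_csf_eq {F : SimpleGraph W} {G : SimpleGraph V} (h : csf F = csf G) :
    Fintype.card W = Fintype.card V := by
  obtain ⟨Φ, hΦ⟩ := exists_colorings_equiv h
  let f : W → ℕ := fun w => Fintype.equivFin W w
  have hf : Function.Injective f := Fin.val_injective.comp (Fintype.equivFin W).injective
  obtain ⟨m, hm⟩ : ∃ m, ∀ v, (Φ ⟨f, fun x y hxy => hf.ne hxy.ne⟩).1 v < 0 + m :=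
    ⟨univ.sup (Φ ⟨f, fun x y hxy => hf.ne hxy.ne⟩).1 + 1, fun v => by
      have := Finset.le_sup (f := (Φ ⟨f, fun x y hxy => hf.ne hxy.ne⟩).1) (mem_univ v)
      omega⟩
  have hm' : ∀ w, f w < 0 + m := by
    rw [forall_lt_iff_card] at hm ⊢
    simpa only [hΦ] using hm
  have h1 := card_le_eq_sum_card _ 0 m hm
  have h2 := card_le_eq_sum_card _ 0 m hm'
  simp only [hΦ, zero_le, filter_true, card_univ] at h1 h2
  rw [h1, h2]

end Csf

section SubtreeCounts

open Finset
open scoped Classical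

variable {V W : Type*}

/-- The number of edges of `G` with both ends in `A`. -/
noncomputable def edgesIn (G : SimpleGraph V) (A : Finset V) : ℕ := arcs G A A / 2

/-- For a forest `G`: the vertex set `A` induces a (nonempty) connected subgraph. -/
def IsSubtree (G : SimpleGraph V) (A : Finset V) : Prop := edgesIn G A + 1 = #A

theorem IsRooting.inner_eq {G : SimpleGraph V} {par : V → Option V} {dep : V → ℕ} {r : V}
    (h : IsRooting G par dep r) (A : Finset V) :
    #{x ∈ A | ∃ p ∈ A, par x = some p} = edgesIn G A := by
  rw [edgesIn, h.arcs_eq]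
  omega

theorem SimpleGraph.IsTree.edgesIn_lt_card {G : SimpleGraph V} (hG : G.IsTree) {A : Finset V}
    (hA : A.Nonempty) : edgesIn G A < #A := by
  obtain ⟨x, hx⟩ := hA
  obtain ⟨par, dep, h⟩ := exists_isRooting hG x
  rw [← h.inner_eq]
  exact h.inner_lt_card ⟨x, hx⟩

variable [Fintype V] [Fintype W]

/-- The number of edges of `G` leaving `A`. -/
noncomputable def cut (G : SimpleGraph V) (A : Finset V) : ℕ := arcs G A Aᶜ

theorem SimpleGraph.IsTree.edgesIn_add_edgesIn_compl_add_cut {G : SimpleGraph V} (hG : G.IsTree)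
    (A : Finset V) : edgesIn G A + edgesIn G Aᶜ + cut G A + 1 = Fintype.card V := by
  obtain ⟨x⟩ := hG.connected.nonempty
  obtain ⟨par, dep, h⟩ := exists_isRooting hG x
  rw [← h.inner_add_inner_compl_add_arcs A, h.inner_eq, h.inner_eq, cut]

theorem SimpleGraph.IsTree.card_two_block_colorings {G : SimpleGraph V} (hG : G.IsTree)
    (q t k : ℕ) :
    #{f ∈ Fintype.piFinset (fun _ : V => range (q + t)) |
        (∀ x y, G.Adj x y → f x ≠ f y) ∧ #{v | q ≤ f v} = k} =
      ∑ A ∈ powersetCard k univ, (t ^ (k - edgesIn G A) * (t - 1) ^ edgesIn G A) *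
        (q ^ (Fintype.card V - k - edgesIn G Aᶜ) * (q - 1) ^ edgesIn G Aᶜ) := by
  obtain ⟨r⟩ := hG.connected.nonempty
  obtain ⟨par, dep, h⟩ := exists_isRooting hG r
  rw [card_eq_sum_card_fiberwise (f := fun f => ({v | q ≤ f v} : Finset V))
    (t := powersetCard k univ)]
  · refine sum_congr rfl fun A hA => ?_
    rw [mem_powersetCard_univ] at hA
    have := h.card_colorings (fun b => if b then Ico q (q + t) else range q) ?_
      (fun x => decide (x ∈ A))
    · have e : {f ∈ {f ∈ Fintype.piFinset (fun _ : V => range (q + t)) |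
          (∀ x y, G.Adj x y → f x ≠ f y) ∧ #{v | q ≤ f v} = k} |
            ({v | q ≤ f v} : Finset V) = A} =
          {f ∈ Fintype.piFinset (fun x => if decide (x ∈ A) then Ico q (q + t) else range q) |
            ∀ x y, G.Adj x y → f x ≠ f y} := by
        ext f
        simp only [mem_filter, Fintype.mem_piFinset, mem_range, decide_eq_true_eq]
        constructor
        · rintro ⟨⟨h1, h2, h3⟩, rfl⟩
          refine ⟨fun x => ?_, h2⟩
          by_cases hx : q ≤ f x
          · simp [hx, h1 x]
          · simp [hx, not_le.1 hx]
        · rintro ⟨h1, h2⟩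
          have hA' : ({v | q ≤ f v} : Finset V) = A := by
            ext x
            have := h1 x
            split_ifs at this with hx
            · simp [hx, (mem_Ico.1 this).1]
            · simpa [hx] using this
          refine ⟨⟨fun x => ?_, h2, by rw [hA', hA]⟩, hA'⟩
          have := h1 x
          split_ifs at this with hx
          · exact (mem_Ico.1 this).2
          · exact (mem_range.1 this).trans_le (Nat.le_add_right _ _)
      rw [e, this, ← prod_mul_prod_compl A]
      have aux : ∀ (B : Finset V) (m : ℕ),
          ∏ x ∈ B, (m - if ∃ p ∈ B, par x = some p then 1 else 0) =
            m ^ (#B - edgesIn G B) * (m - 1) ^ edgesIn G B := by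
        intro B m
        have : ∀ x ∈ B, (m - if ∃ p ∈ B, par x = some p then 1 else 0) =
            if ∃ p ∈ B, par x = some p then m - 1 else m := by
          intro x _
          split_ifs <;> simp
        rw [prod_congr rfl this, prod_ite, prod_const, prod_const, h.inner_eq, mul_comm,
          ← h.inner_eq B]
        congr 2
        have := card_filter_add_card_filter_not (s := B) (fun x => ∃ p ∈ B, par x = some p)
        omega
      congr 1
      · rw [← hA, ← aux A t]
        refine prod_congr rfl fun x hx => ?_
        simp only [hx, decide_true, if_true, Nat.card_Ico, Nat.add_sub_cancel_left,
          decide_eq_true_eq]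
        congr 2
        simp only [and_comm]
      · rw [← hA, ← card_compl, ← aux Aᶜ q]
        refine prod_congr rfl fun x hx => ?_
        rw [mem_compl] at hx
        simp only [hx, decide_false, decide_eq_false_iff_not, mem_compl]
        simp only [Bool.false_eq_true, if_false, card_range]
        congr 2
        simp only [and_comm]
    · rw [Finset.disjoint_left]
      intro x hx
      simp only [if_true, mem_Ico] at hx
      simp [hx.1]
  · intro f hf
    simp only [coe_filter, Set.mem_ofPred_eq] at hf
    simpa using hf.2.2

theorem filter_two_block_zero (G : SimpleGraph V) (q : ℕ) :
    {f ∈ Fintype.piFinset (fun _ : V => range (q + 0)) |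
        (∀ x y, G.Adj x y → f x ≠ f y) ∧ #{u | q ≤ f u} = 0} =
      {f ∈ Fintype.piFinset (fun _ : V => range q) | ∀ x y, G.Adj x y → f x ≠ f y} := by
  apply filter_congr
  intro f hf
  simp only [Fintype.mem_piFinset, mem_range, add_zero] at hf
  simp [hf]

theorem SimpleGraph.IsTree.card_colorings {G : SimpleGraph V} (hG : G.IsTree) (q : ℕ) :
    #{f ∈ Fintype.piFinset (fun _ : V => range q) | ∀ x y, G.Adj x y → f x ≠ f y} =
      q * (q - 1) ^ (Fintype.card V - 1) := by
  have h := hG.card_two_block_colorings q 0 0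
  have h1 := hG.edgesIn_add_edgesIn_compl_add_cut ∅
  have e0 : edgesIn G ∅ = 0 := by simp [edgesIn, arcs]
  have e1 : cut G ∅ = 0 := by simp [cut, arcs]
  rw [e0, e1, compl_empty] at h1
  simp only [filter_two_block_zero, powersetCard_zero, sum_singleton, e0, compl_empty] at h
  rw [show edgesIn G univ = Fintype.card V - 1 by omega,
    show Fintype.card V - 0 - (Fintype.card V - 1) = 1 by omega] at h
  simpa only [Nat.sub_zero, pow_zero, pow_one, one_mul, add_zero] using h

theorem card_colorings_eq {F : SimpleGraph W} {G : SimpleGraph V} (h : csf F = csf G) (q : ℕ) :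
    #{f ∈ Fintype.piFinset (fun _ : W => range q) | ∀ x y, F.Adj x y → f x ≠ f y} =
      #{f ∈ Fintype.piFinset (fun _ : V => range q) | ∀ x y, G.Adj x y → f x ≠ f y} := by
  rw [← filter_two_block_zero, ← filter_two_block_zero, card_two_block_colorings_eq h]

theorem isTree_of_csf_eq {F : SimpleGraph W} {G : SimpleGraph V} (hG : G.IsTree)
    (h : csf F = csf G) : F.IsTree := by
  have hcard := card_eq_of_csf_eq h
  have hcol : ∀ q, #{f ∈ Fintype.piFinset (fun _ : W => range q) |
      ∀ x y, F.Adj x y → f x ≠ f y} = q * (q - 1) ^ (Fintype.card W - 1) := by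
    intro q
    rw [card_colorings_eq h, hG.card_colorings, hcard]
  have : Nonempty W := by
    rw [← Fintype.card_pos_iff, hcard, Fintype.card_pos_iff]
    exact hG.connected.nonempty
  have hconn : F.Connected := by
    rw [connected_iff]
    refine ⟨?_, ‹_›⟩
    intro a b
    by_contra hab
    have h2 := hcol 2
    rw [Nat.add_sub_cancel_left (n := 1) (m := 1), one_pow, mul_one] at h2
    obtain ⟨f, hf⟩ : ({f ∈ Fintype.piFinset (fun _ : W => range 2) |
      ∀ x y, F.Adj x y → f x ≠ f y} : Finset (W → ℕ)).Nonempty := by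
      rw [← card_pos]; omega
    simp only [mem_filter, Fintype.mem_piFinset, mem_range] at hf
    let g : W → ℕ := fun x => if F.Reachable a x then f x else 1 - f x
    have hsub : ({f, fun x => 1 - f x, g} : Finset (W → ℕ)) ⊆
        {f ∈ Fintype.piFinset (fun _ : W => range 2) | ∀ x y, F.Adj x y → f x ≠ f y} := by
      intro k hk
      simp only [mem_insert, mem_singleton] at hk
      simp only [mem_filter, Fintype.mem_piFinset, mem_range]
      rcases hk with rfl | rfl | rfl
      · exact hf
      · refine ⟨fun x => by dsimp only; omega, fun x y hxy => ?_⟩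
        dsimp only
        have := hf.2 x y hxy
        have := hf.1 x
        have := hf.1 y
        omega
      · refine ⟨fun x => ?_, fun x y hxy => ?_⟩
        · have := hf.1 x
          simp only [g]
          split_ifs <;> omega
        · have := hf.2 x y hxy
          have := hf.1 x
          have := hf.1 y
          have : F.Reachable a x ↔ F.Reachable a y :=
            ⟨fun h => h.trans hxy.reachable, fun h => h.trans hxy.symm.reachable⟩
          simp only [g, this]
          split_ifs <;> omega
    have hle := card_le_card hsub
    have ha : F.Reachable a a := Reachable.refl a
    have hfa := hf.1 a
    have hfb := hf.1 b
    rw [h2, card_eq_three.2 ⟨f, fun x => 1 - f x, g, ?_, ?_, ?_, rfl⟩] at hle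
    · omega
    · intro e
      have := congrFun e a
      omega
    · intro e
      have := congrFun e b
      simp only [g, hab, if_false] at this
      omega
    · intro e
      have := congrFun e a
      simp only [g, ha, if_true] at this
      omega
  obtain ⟨S, hSF, hS⟩ := hconn.exists_isTree_le
  suffices F = S by rwa [this]
  refine le_antisymm ?_ hSF
  intro x y hxy
  by_contra hS'
  have hsub : ∀ q, {f ∈ Fintype.piFinset (fun _ : W => range q) |
        ∀ x y, F.Adj x y → f x ≠ f y} =
      {f ∈ Fintype.piFinset (fun _ : W => range q) | ∀ x y, S.Adj x y → f x ≠ f y} := by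
    intro q
    apply eq_of_subset_of_card_le
    · intro f hf
      simp only [mem_filter] at hf ⊢
      exact ⟨hf.1, fun x y h => hf.2 x y (hSF h)⟩
    · rw [hcol, hS.card_colorings]
  let c : W → ℕ := fun v => if v = x ∨ v = y then 0 else Fintype.equivFin W v + 1
  have hc : c ∈ ({f ∈ Fintype.piFinset (fun _ : W => range (Fintype.card W + 1)) |
      ∀ x y, S.Adj x y → f x ≠ f y} : Finset (W → ℕ)) := by
    simp only [mem_filter, Fintype.mem_piFinset, mem_range]
    refine ⟨fun v => ?_, fun v w hvw => ?_⟩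
    · simp only [c]
      split_ifs <;> omega
    · have hne := hvw.ne
      simp only [c]
      split_ifs with h1 h2 h2
      · exfalso
        rcases h1 with rfl | rfl <;> rcases h2 with rfl | rfl
        · exact hne rfl
        · exact hS' hvw
        · exact hS' hvw.symm
        · exact hne rfl
      · omega
      · omega
      · intro e
        exact hne ((Fintype.equivFin W).injective (Fin.ext (by omega)))
  rw [← hsub] at hc
  exact (mem_filter.1 hc).2 x y hxy (by simp [c])

/-- The number of vertex sets of size `k` with cut `m` inducing a connected subgraph. -/
noncomputable def subtreeCount (G : SimpleGraph V) (k m : ℕ) : ℕ :=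
  #{A | IsSubtree G A ∧ #A = k ∧ cut G A = m}

open Polynomial in
theorem SimpleGraph.IsTree.exists_polynomial {G : SimpleGraph V} (hG : G.IsTree) (q : ℕ) {k : ℕ}
    (hk : k ≠ 0) : ∃ P : ℤ[X],
      (∀ t : ℕ, 1 ≤ t → P.eval (t : ℤ) =
        #{f ∈ Fintype.piFinset (fun _ : V => range (q + t)) |
          (∀ x y, G.Adj x y → f x ≠ f y) ∧ #{v | q ≤ f v} = k}) ∧
      P.coeff 1 = (-1) ^ (k - 1) * ∑ A with IsSubtree G A ∧ #A = k,
        ((q ^ (Fintype.card V - k - edgesIn G Aᶜ) * (q - 1) ^ edgesIn G Aᶜ : ℕ) : ℤ) := by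
  refine ⟨∑ A ∈ powersetCard k univ, (X ^ (k - edgesIn G A) * (X - 1) ^ edgesIn G A) *
    C ((q ^ (Fintype.card V - k - edgesIn G Aᶜ) * (q - 1) ^ edgesIn G Aᶜ : ℕ) : ℤ), ?_, ?_⟩
  · intro t ht
    rw [hG.card_two_block_colorings, eval_finsetSum, Nat.cast_sum]
    refine sum_congr rfl fun A _ => ?_
    simp [Nat.cast_sub ht]
  · rw [finsetSum_coeff, mul_sum,
      show ({A | IsSubtree G A ∧ #A = k} : Finset (Finset V)) =
        {A ∈ powersetCard k (univ : Finset V) | IsSubtree G A} by ext A; simp [and_comm],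
      sum_filter]
    refine sum_congr rfl fun A hA => ?_
    rw [mem_powersetCard_univ] at hA
    have hlt := hG.edgesIn_lt_card (card_pos.1 (by omega : 0 < #A))
    rw [coeff_mul_C]
    split_ifs with h
    · congr 1
      rw [IsSubtree] at h
      rw [show k - edgesIn G A = 1 by omega, show edgesIn G A = k - 1 by omega, pow_one,
        show (1 : ℕ) = 0 + 1 from rfl, coeff_X_mul, coeff_zero_eq_eval_zero]
      simp
    · rw [IsSubtree] at h
      rw [coeff_X_pow_mul', if_neg (by omega), zero_mul]

theorem sum_subtree_eq {F : SimpleGraph W} {G : SimpleGraph V} (hF : F.IsTree) (hG : G.IsTree)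
    (h : csf F = csf G) (q k : ℕ) :
    ∑ A with IsSubtree F A ∧ #A = k,
        ((q ^ (Fintype.card W - k - edgesIn F Aᶜ) * (q - 1) ^ edgesIn F Aᶜ : ℕ) : ℤ) =
      ∑ A with IsSubtree G A ∧ #A = k,
        ((q ^ (Fintype.card V - k - edgesIn G Aᶜ) * (q - 1) ^ edgesIn G Aᶜ : ℕ) : ℤ) := by
  rcases eq_or_ne k 0 with rfl | hk
  · rw [filter_false_of_mem, filter_false_of_mem, sum_empty, sum_empty]
    all_goals
      rintro A - ⟨h1, h2⟩
      exact Nat.succ_ne_zero _ (h1.trans h2)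
  · obtain ⟨P, hP, hP1⟩ := hF.exists_polynomial q hk
    obtain ⟨Q, hQ, hQ1⟩ := hG.exists_polynomial q hk
    have hPQ : P = Q := by
      apply Polynomial.eq_of_infinite_eval_eq
      refine Set.Infinite.mono (s := Set.range fun n : ℕ => ((n + 1 : ℕ) : ℤ)) ?_ ?_
      · rintro _ ⟨n, rfl⟩
        simp only [Set.mem_ofPred_eq]
        rw [hP _ (by omega), hQ _ (by omega), card_two_block_colorings_eq h]
      · exact Set.infinite_range_of_injective fun a b hab => by simpa using hab
    rw [hPQ, hQ1] at hP1
    exact (mul_left_cancel₀ (pow_ne_zero _ (by norm_num)) hP1).symm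

theorem SimpleGraph.IsTree.sum_subtree_eq_mul {G : SimpleGraph V} (hG : G.IsTree) (q k : ℕ) :
    ((∑ A with IsSubtree G A ∧ #A = k,
      ((q + 2) ^ (Fintype.card V - k - edgesIn G Aᶜ) * (q + 1) ^ edgesIn G Aᶜ : ℕ) : ℕ) : ℚ) =
    (q + 1) ^ (Fintype.card V - k) *
      ∑ A with IsSubtree G A ∧ #A = k, (1 + 1 / (q + 1) : ℚ) ^ cut G A := by
  rw [mul_sum, Nat.cast_sum]
  refine sum_congr rfl fun A hA => ?_
  replace hA := (mem_filter.1 hA).2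
  rw [IsSubtree] at hA
  have := hG.edgesIn_add_edgesIn_compl_add_cut A
  rw [show Fintype.card V - k - edgesIn G Aᶜ = cut G A by omega,
    show Fintype.card V - k = cut G A + edgesIn G Aᶜ by omega]
  have hq : (q + 1 : ℚ) ≠ 0 := by positivity
  rw [show (1 + 1 / (q + 1) : ℚ) = (q + 2) / (q + 1) by field_simp; ring, div_pow, pow_add]
  push_cast
  field_simp

open Polynomial in
theorem coeff_sum_subtree (G : SimpleGraph V) (k m : ℕ) :
    (∑ A with IsSubtree G A ∧ #A = k, (X : ℚ[X]) ^ cut G A).coeff m = subtreeCount G k m := by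
  rw [finsetSum_coeff, subtreeCount]
  simp only [coeff_X_pow]
  rw [sum_boole, filter_filter]
  simp only [and_assoc, eq_comm]

open Polynomial in
theorem subtreeCount_eq {F : SimpleGraph W} {G : SimpleGraph V} (hF : F.IsTree) (hG : G.IsTree)
    (h : csf F = csf G) (k m : ℕ) : subtreeCount F k m = subtreeCount G k m := by
  have : ∑ A with IsSubtree F A ∧ #A = k, (X : ℚ[X]) ^ cut F A =
      ∑ A with IsSubtree G A ∧ #A = k, (X : ℚ[X]) ^ cut G A := by
    apply eq_of_infinite_eval_eq
    refine Set.Infinite.mono (s := Set.range fun n : ℕ => (1 + 1 / (n + 1) : ℚ)) ?_ ?_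
    · rintro _ ⟨q, rfl⟩
      have hs := sum_subtree_eq hF hG h (q + 2) k
      rw [← Nat.cast_sum, ← Nat.cast_sum, Nat.cast_inj, ← Nat.cast_inj (R := ℚ)] at hs
      have e1 := hF.sum_subtree_eq_mul q k
      have e2 := hG.sum_subtree_eq_mul q k
      rw [show q + 2 - 1 = q + 1 from rfl] at hs
      rw [e1, e2, card_eq_of_csf_eq h] at hs
      simp only [Set.mem_ofPred_eq, eval_finsetSum, eval_pow, eval_X]
      exact mul_left_cancel₀ (by positivity) hs
    · apply Set.infinite_range_of_injective
      intro a b hab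
      simpa using hab
  have := congrArg (fun P => coeff P m) this
  simp only [coeff_sum_subtree] at this
  exact_mod_cast this

end SubtreeCounts

section SubtreeSums

open Finset
open scoped Classical

variable {V W R : Type*}

theorem arcs_map {F : SimpleGraph V} {G : SimpleGraph W} (e : F ≃g G) (A B : Finset V) :
    arcs G (A.map e.toEquiv.toEmbedding) (B.map e.toEquiv.toEmbedding) = arcs F A B := by
  have hm : ∀ (S : Finset V) a, e a ∈ S.map e.toEquiv.toEmbedding ↔ a ∈ S :=
    fun _ _ => mem_map' _
  symm
  refine card_bij (fun p _ => (e p.1, e p.2)) ?_ ?_ ?_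
  · intro p hp
    simpa only [mem_filter, mem_product, hm, Iso.map_adj_iff] using hp
  · rintro ⟨a, b⟩ - ⟨a', b'⟩ - h
    simpa using h
  · rintro ⟨a, b⟩ h
    obtain ⟨a, rfl⟩ := e.surjective a
    obtain ⟨b, rfl⟩ := e.surjective b
    simp only [mem_filter, mem_product, hm, Iso.map_adj_iff] at h
    exact ⟨(a, b), by simpa only [mem_filter, mem_product] using h, rfl⟩

theorem isSubtree_map {F : SimpleGraph V} {G : SimpleGraph W} (e : F ≃g G) (A : Finset V) :
    IsSubtree G (A.map e.toEquiv.toEmbedding) ↔ IsSubtree F A := by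
  rw [IsSubtree, IsSubtree, edgesIn, edgesIn, arcs_map, card_map]

theorem IsRooting.isSubtree_iff {G : SimpleGraph V} {par : V → Option V} {dep : V → ℕ} {r : V}
    (h : IsRooting G par dep r) (A : Finset V) :
    IsSubtree G A ↔ #{x ∈ A | ∃ p ∈ A, par x = some p} + 1 = #A := by
  rw [IsSubtree, h.inner_eq]

variable [Fintype V] [Fintype W]

theorem cut_map {F : SimpleGraph V} {G : SimpleGraph W} (e : F ≃g G) (A : Finset V) :
    cut G (A.map e.toEquiv.toEmbedding) = cut F A := by
  rw [cut, cut, ← arcs_map e]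
  congr 1
  ext x
  simp

theorem sum_deg (G : SimpleGraph V) (A : Finset V) :
    ∑ x ∈ A, deg G x = arcs G A A + cut G A := by
  have key : ∀ B, arcs G A B = ∑ x ∈ A, #{y ∈ B | G.Adj x y} := by
    intro B
    rw [arcs, card_filter, sum_product]
    simp only [card_filter]
  rw [cut, key, key, ← sum_add_distrib]
  refine sum_congr rfl fun x _ => ?_
  rw [← card_union_of_disjoint (disjoint_filter_filter (disjoint_compl_right (α := Finset V))),
    ← filter_union, union_compl, deg, Nat.card_eq_fintype_card, Fintype.card_subtype]
  simp

theorem IsRooting.cut_add {G : SimpleGraph V} {par : V → Option V} {dep : V → ℕ} {r : V}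
    (h : IsRooting G par dep r) {A : Finset V} (hA : IsSubtree G A) :
    cut G A + 2 * #A = 2 + ∑ x ∈ A, deg G x := by
  rw [sum_deg, h.arcs_eq A A]
  rw [h.isSubtree_iff] at hA
  omega

theorem subtreeCount_one (G : SimpleGraph V) (m : ℕ) :
    subtreeCount G 1 m = #{v | deg G v = m} := by
  have harcs : ∀ v, arcs G {v} {v} = 0 := by
    intro v
    simp [arcs]
  have hcut : ∀ v, cut G {v} = deg G v := by
    intro v
    have := sum_deg G {v}
    rw [harcs, sum_singleton] at this
    omega
  symm
  refine card_bij (fun v _ => {v}) ?_ ?_ ?_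
  · intro v hv
    refine mem_filter.2 ⟨mem_univ _, ?_⟩
    simpa [IsSubtree, edgesIn, harcs, hcut] using hv
  · intro v _ w _ h
    simpa using h
  · intro A hA
    obtain ⟨-, h1, h2⟩ := (mem_filter.1 hA).2
    obtain ⟨v, rfl⟩ := card_eq_one.1 h1
    exact ⟨v, by simpa [hcut] using h2, rfl⟩

/-- The generating function of the vertex sets inducing a connected subgraph, by cut and size. -/
noncomputable def subtreeSum [CommRing R] (G : SimpleGraph V) (y z : R) : R :=
  ∑ A with IsSubtree G A, y ^ cut G A * z ^ #A

theorem subtreeSum_map [CommRing R] {F : SimpleGraph V} {G : SimpleGraph W} (e : F ≃g G)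
    (y z : R) : subtreeSum F y z = subtreeSum G y z := by
  rw [subtreeSum, subtreeSum, sum_filter, sum_filter]
  refine Fintype.sum_equiv e.toEquiv.finsetCongr _ _ fun A => ?_
  rw [Equiv.finsetCongr_apply, isSubtree_map, cut_map, card_map]

theorem multiset_subtree_eq {F : SimpleGraph W} {G : SimpleGraph V} (hF : F.IsTree)
    (hG : G.IsTree) (h : csf F = csf G) :
    (univ.filter (IsSubtree F)).val.map (fun A => (#A, cut F A)) =
      (univ.filter (IsSubtree G)).val.map (fun A => (#A, cut G A)) := by
  ext ⟨k, m⟩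
  have := subtreeCount_eq hF hG h k m
  rw [subtreeCount, subtreeCount] at this
  rw [Multiset.count_map, Multiset.count_map]
  convert this using 1
  all_goals
    rw [← filter_val, filter_filter, card_val]
    simp only [Prod.mk.injEq, eq_comm]

theorem subtreeSum_eq [CommRing R] {F : SimpleGraph W} {G : SimpleGraph V} (hF : F.IsTree)
    (hG : G.IsTree) (h : csf F = csf G) (y z : R) : subtreeSum F y z = subtreeSum G y z := by
  have := congrArg (fun M => (M.map fun p : ℕ × ℕ => y ^ p.2 * z ^ p.1).sum)
    (multiset_subtree_eq hF hG h)
  simpa [Multiset.map_map, subtreeSum, Finset.sum] using this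

theorem card_deg_eq {F : SimpleGraph W} {G : SimpleGraph V} (hF : F.IsTree)
    (hG : G.IsTree) (h : csf F = csf G) :
    #{v | 3 ≤ deg F v} = #{v | 3 ≤ deg G v} := by
  have key : (univ : Finset W).val.map (deg F) = (univ : Finset V).val.map (deg G) := by
    ext m
    have := subtreeCount_eq hF hG h 1 m
    rw [subtreeCount_one, subtreeCount_one] at this
    rw [Multiset.count_map, Multiset.count_map, ← filter_val, ← filter_val, card_val, card_val]
    simpa only [eq_comm] using this
  have := congrArg (fun M => M.countP (3 ≤ ·)) key
  simpa [Multiset.countP_map, ← filter_val] using this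

/-- The weight of a non-root vertex, according to whether its parent and itself are selected. -/
def edgeWeight [CommRing R] (y z : R) : Bool → Bool → R
  | true, true => z
  | true, false => y
  | false, true => 0
  | false, false => 1

theorem IsRooting.prod_weight [CommRing R] {G : SimpleGraph V} {par : V → Option V} {dep : V → ℕ}
    {r : V} (h : IsRooting G par dep r) {A : Finset V} (hr : r ∈ A) (y z : R) :
    (if IsSubtree G A then y ^ cut G A * z ^ #A else 0) =
      ∏ x, (par x).elim z fun p => edgeWeight y z (decide (p ∈ A)) (decide (x ∈ A)) := by
  have hw : ∀ x, ((par x).elim z fun p => edgeWeight y z (decide (p ∈ A)) (decide (x ∈ A))) =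
      if x ∈ A then (if ∃ p ∉ A, par x = some p then 0 else z)
        else (if ∃ p ∈ A, par x = some p then y else 1) := by
    intro x
    cases hx : par x with
    | none =>
      obtain rfl := (h.root_iff x).1 hx
      simp [hr]
    | some p => by_cases h1 : p ∈ A <;> by_cases h2 : x ∈ A <;> simp [h1, h2, edgeWeight]
  simp only [hw]
  have hsub : IsSubtree G A ↔ ∀ x ∈ A, ¬ ∃ p ∉ A, par x = some p := by
    have hss : ({x ∈ A | ∃ p ∈ A, par x = some p} : Finset V) ⊆ A.erase r := by
      intro x hx
      obtain ⟨hx, p, -, hp⟩ := mem_filter.1 hx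
      refine mem_erase.2 ⟨?_, hx⟩
      rintro rfl
      rw [(h.root_iff x).2 rfl] at hp
      cases hp
    have hc : #(A.erase r) + 1 = #A := card_erase_add_one hr
    have h1 : IsSubtree G A ↔ #{x ∈ A | ∃ p ∈ A, par x = some p} = #(A.erase r) := by
      rw [h.isSubtree_iff]
      omega
    rw [h1]
    constructor
    · rintro hcard x hx ⟨p, hp, hpar⟩
      have hx' : x ∈ A.erase r :=
        mem_erase.2 ⟨fun hxr => by simp [(h.root_iff x).2 hxr] at hpar, hx⟩
      rw [← eq_of_subset_of_card_le hss hcard.ge] at hx'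
      obtain ⟨-, q, hq, hqar⟩ := mem_filter.1 hx'
      rw [hpar] at hqar
      cases hqar
      exact hp hq
    · intro H
      congr 1
      refine hss.antisymm fun x hx => ?_
      obtain ⟨hxr, hx⟩ := mem_erase.1 hx
      refine mem_filter.2 ⟨hx, ?_⟩
      obtain ⟨p, hp⟩ := Option.ne_none_iff_exists'.1 (mt (h.root_iff x).1 hxr)
      refine ⟨p, ?_, hp⟩
      by_contra hpA
      exact H x hx ⟨p, hpA, hp⟩
  split_ifs with hA
  · rw [hsub] at hA
    have hcut : cut G A = #{x | x ∉ A ∧ ∃ p ∈ A, par x = some p} := by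
      rw [cut, h.arcs_eq, filter_false_of_mem, card_empty, zero_add, ← filter_filter]
      · congr 2
        ext x
        simp
      · simpa using hA
    rw [hcut, prod_ite,
      prod_congr rfl (g := fun _ => z) (fun x hx => if_neg (hA x (by simpa using hx))), prod_ite,
      filter_filter, mul_comm]
    simp
  · rw [hsub] at hA
    push Not at hA
    obtain ⟨x, hx, hp⟩ := hA
    rw [prod_eq_zero (mem_univ x)]
    rw [if_pos hx, if_pos hp]

end SubtreeSums

section TwoHub

open Finset
open scoped Classical

variable {ι R : Type*}

/-- The parent function of the tree made of a path `0, …, d` and, for each `i`, a further path with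
`γ i` vertices hanging from `0` if `σ i` and from `d` otherwise. -/
def twoHubPar (d : ℕ) (γ : ι → ℕ) (σ : ι → Bool) :
    Fin (d + 1) ⊕ (Σ i, Fin (γ i)) → Option (Fin (d + 1) ⊕ (Σ i, Fin (γ i)))
  | .inl k => if k.1 = 0 then none else some (.inl ⟨k.1 - 1, by omega⟩)
  | .inr ⟨i, j⟩ => some (if j.1 = 0 then .inl (if σ i then 0 else Fin.last d)
      else .inr ⟨i, ⟨j.1 - 1, by omega⟩⟩)

/-- The distance to the vertex `0`. -/
def twoHubDep (d : ℕ) (γ : ι → ℕ) (σ : ι → Bool) : Fin (d + 1) ⊕ (Σ i, Fin (γ i)) → ℕ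
  | .inl k => k
  | .inr ⟨i, j⟩ => (if σ i then 0 else d) + j + 1

theorem twoHubDep_eq (d : ℕ) (γ : ι → ℕ) (σ : ι → Bool) (x y : Fin (d + 1) ⊕ (Σ i, Fin (γ i)))
    (h : twoHubPar d γ σ x = some y) : twoHubDep d γ σ x = twoHubDep d γ σ y + 1 := by
  rcases x with k | ⟨i, j⟩
  · simp only [twoHubPar] at h
    split_ifs at h with hk
    cases h
    simp only [twoHubDep]
    omega
  · simp only [twoHubPar, Option.some.injEq] at h
    subst h
    split_ifs with hj hσ <;> simp only [twoHubDep, Fin.val_zero, Fin.val_last] <;> simp_all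
    all_goals omega

/-- The tree made of a path `0, …, d` and, for each `i`, a further path with `γ i` vertices
hanging from `0` if `σ i` and from `d` otherwise. -/
def twoHub (d : ℕ) (γ : ι → ℕ) (σ : ι → Bool) : SimpleGraph (Fin (d + 1) ⊕ (Σ i, Fin (γ i))) where
  Adj x y := twoHubPar d γ σ x = some y ∨ twoHubPar d γ σ y = some x
  symm := ⟨fun _ _ h => h.symm⟩
  loopless := ⟨fun x h => by
    have := twoHubDep_eq d γ σ x x (h.elim id id)
    omega⟩

theorem twoHub_isRooting (d : ℕ) (γ : ι → ℕ) (σ : ι → Bool) :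
    IsRooting (twoHub d γ σ) (twoHubPar d γ σ) (twoHubDep d γ σ) (.inl 0) where
  adj_iff _ _ := Iff.rfl
  dep_eq := twoHubDep_eq d γ σ
  root_iff x := by
    rcases x with k | ⟨i, j⟩
    · by_cases hk : k = 0 <;> simp [twoHubPar, hk]
    · simp [twoHubPar]
  dep_root := rfl

theorem twoHub_adj_flip (d : ℕ) (γ : ι → ℕ) (σ : ι → Bool) (x y : Fin (d + 1) ⊕ (Σ i, Fin (γ i)))
    (h : (twoHub d γ σ).Adj x y) :
    (twoHub d γ fun i => !σ i).Adj (Sum.map Fin.rev id x) (Sum.map Fin.rev id y) := by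
  have key : ∀ x y, twoHubPar d γ σ x = some y →
      (twoHub d γ fun i => !σ i).Adj (Sum.map Fin.rev id x) (Sum.map Fin.rev id y) := by
    rintro (k | ⟨i, j⟩) y h
    · simp only [twoHubPar] at h
      split_ifs at h with hk
      cases h
      right
      simp only [Sum.map_inl, twoHubPar, Fin.val_rev]
      rw [if_neg (by omega)]
      simp only [Option.some.injEq, Sum.inl.injEq, Fin.ext_iff, Fin.val_rev]
      omega
    · simp only [twoHubPar, Option.some.injEq] at h
      subst h
      left
      cases hσ : σ i <;> by_cases hj : j.1 = 0 <;> simp [twoHubPar, hσ, hj]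
  rcases h with h | h
  · exact key x y h
  · exact (key y x h).symm

/-- Exchanging the two hubs. -/
def twoHubFlip (d : ℕ) (γ : ι → ℕ) (σ : ι → Bool) :
    twoHub d γ σ ≃g twoHub d γ fun i => !σ i where
  toFun := Sum.map Fin.rev id
  invFun := Sum.map Fin.rev id
  left_inv x := by rcases x with k | x <;> simp
  right_inv x := by rcases x with k | x <;> simp
  map_rel_iff' {x y} := by
    refine ⟨fun h => ?_, twoHub_adj_flip d γ σ x y⟩
    have := twoHub_adj_flip d γ _ _ _ h
    have hinv : ∀ x : Fin (d + 1) ⊕ (Σ i, Fin (γ i)),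
        Sum.map Fin.rev id (Sum.map Fin.rev id x) = x := by
      rintro (x | x) <;> simp
    simpa only [Equiv.coe_fn_mk, hinv, Bool.not_not] using this

theorem twoHub_iso_of_equiv {κ : Type*} (d : ℕ) {γ : ι → ℕ} {σ : ι → Bool} {γ' : κ → ℕ}
    {σ' : κ → Bool} (e : ι ≃ κ) (hγ : ∀ i, γ' (e i) = γ i) (hσ : ∀ i, σ' (e i) = σ i) :
    Nonempty (twoHub d γ σ ≃g twoHub d γ' σ') := by
  obtain rfl : (fun i => γ' (e i)) = γ := funext hγ
  obtain rfl : (fun i => σ' (e i)) = σ := funext hσ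
  let E : Fin (d + 1) ⊕ (Σ i, Fin (γ' (e i))) ≃ Fin (d + 1) ⊕ (Σ i, Fin (γ' i)) :=
    (Equiv.refl _).sumCongr (Equiv.sigmaCongrLeft (β := fun i => Fin (γ' i)) e)
  have hpar : ∀ x, twoHubPar d γ' σ' (E x) =
      (twoHubPar d (fun i => γ' (e i)) (fun i => σ' (e i)) x).map E := by
    rintro (k | ⟨i, j⟩)
    · simp only [E, twoHubPar, Equiv.sumCongr_apply, Sum.map_inl, Equiv.refl_apply]
      split_ifs <;> simp
    · simp only [E, twoHubPar, Equiv.sumCongr_apply, Sum.map_inr, Equiv.sigmaCongrLeft_apply]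
      split_ifs <;> simp
  exact ⟨((twoHub_isRooting _ _ _).exists_iso (twoHub_isRooting _ _ _) E hpar).choose⟩

variable [CommRing R]

/-- The weight of a selection of the vertices of a path hanging from a vertex. -/
def chainWeight (y z : R) {n : ℕ} (b : Bool) (h : Fin n → Bool) : R :=
  ∏ j : Fin n, edgeWeight y z ((Fin.cons b h : Fin (n + 1) → Bool) j.castSucc) (h j)

theorem chainWeight_cons (y z : R) {n : ℕ} (b c : Bool) (h : Fin n → Bool) :
    chainWeight y z b (Fin.cons c h : Fin (n + 1) → Bool) =
      edgeWeight y z b c * chainWeight y z c h := by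
  simp [chainWeight, Fin.prod_univ_succ]

theorem sum_chainWeight (y z : R) (n : ℕ) (b : Bool) (φ : Bool → R) :
    ∑ h : Fin n → Bool, chainWeight y z b h * φ ((Fin.cons b h : Fin (n + 1) → Bool) (Fin.last n)) =
      if b then z ^ n * φ true + y * (∑ j ∈ range n, z ^ j) * φ false else φ false := by
  induction n generalizing b with
  | zero => cases b <;> simp [chainWeight]
  | succ n ih =>
    rw [← (Fin.consEquiv fun _ => Bool).sum_comp, Fintype.sum_prod_type]
    simp only [Fin.consEquiv, Equiv.coe_fn_mk, chainWeight_cons, ← Fin.succ_last, Fin.cons_succ,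
      mul_assoc, ← mul_sum, ih, Fintype.sum_bool]
    cases b
    · simp [edgeWeight]
    · simp only [edgeWeight, if_true, sum_range_succ', pow_succ, ← sum_mul]
      simp
      ring

/-- The generating function of the initial segments of a path with `n` vertices. -/
def legSum (y z : R) (n : ℕ) : R := z ^ n + y * ∑ j ∈ range n, z ^ j

theorem sum_chainWeight_eq_legSum (y z : R) (n : ℕ) (b : Bool) :
    ∑ h : Fin n → Bool, chainWeight y z b h = if b then legSum y z n else 1 := by
  simpa [legSum] using sum_chainWeight y z n b fun _ => 1

variable [Fintype ι]

/-- Sets of vertices, described path by path. -/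
noncomputable def twoHubSets (d : ℕ) (γ : ι → ℕ) :
    Bool × (Fin d → Bool) × ((i : ι) → Fin (γ i) → Bool) ≃
      Finset (Fin (d + 1) ⊕ (Σ i, Fin (γ i))) where
  toFun t := {x | Sum.elim (Fin.cons t.1 t.2.1 : Fin (d + 1) → Bool) (fun s => t.2.2 s.1 s.2) x}
  invFun A := (decide (.inl 0 ∈ A), fun j => decide (.inl j.succ ∈ A),
    fun i j => decide (.inr ⟨i, j⟩ ∈ A))
  left_inv t := by simp
  right_inv A := by
    ext x
    rcases x with k | x
    · refine Fin.cases ?_ (fun k => ?_) k <;> simp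
    · simp

theorem mem_twoHubSets_inl {d : ℕ} {γ : ι → ℕ}
    (t : Bool × (Fin d → Bool) × ((i : ι) → Fin (γ i) → Bool)) (k : Fin (d + 1)) :
    .inl k ∈ twoHubSets d γ t ↔ (Fin.cons t.1 t.2.1 : Fin (d + 1) → Bool) k := by
  simp [twoHubSets]

theorem mem_twoHubSets_inr {d : ℕ} {γ : ι → ℕ}
    (t : Bool × (Fin d → Bool) × ((i : ι) → Fin (γ i) → Bool)) (i : ι) (j : Fin (γ i)) :
    .inr ⟨i, j⟩ ∈ twoHubSets d γ t ↔ t.2.2 i j := by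
  simp [twoHubSets]

theorem cons_castSucc (b : Bool) {n : ℕ} (h : Fin n → Bool) (j : Fin n) :
    (Fin.cons b h : Fin (n + 1) → Bool) j.castSucc =
      if j.1 = 0 then b else h ⟨j.1 - 1, by omega⟩ := by
  cases n with
  | zero => exact j.elim0
  | succ n =>
    refine Fin.cases (by simp) (fun j => ?_) j
    rw [← Fin.succ_castSucc, Fin.cons_succ]
    simp
    rfl

theorem sum_subtree_hub (d : ℕ) (γ : ι → ℕ) (σ : ι → Bool) (y z : R) (ψ : Bool → R) :
    ∑ A with .inl 0 ∈ A ∧ IsSubtree (twoHub d γ σ) A,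
        y ^ cut (twoHub d γ σ) A * z ^ #A * ψ (decide (.inl (Fin.last d) ∈ A)) =
      z * (z ^ d * (∏ i, legSum y z (γ i)) * ψ true +
        y * (∑ j ∈ range d, z ^ j) * (∏ i with σ i, legSum y z (γ i)) * ψ false) := by
  have hsummand : ∀ t, (if .inl 0 ∈ twoHubSets d γ t ∧ IsSubtree (twoHub d γ σ) (twoHubSets d γ t)
      then y ^ cut (twoHub d γ σ) (twoHubSets d γ t) * z ^ #(twoHubSets d γ t) *
        ψ (decide (.inl (Fin.last d) ∈ twoHubSets d γ t)) else 0) =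
      if t.1 then z * chainWeight y z t.1 t.2.1 * (∏ i, chainWeight y z
        (if σ i then t.1 else (Fin.cons t.1 t.2.1 : Fin (d + 1) → Bool) (Fin.last d)) (t.2.2 i)) *
        ψ ((Fin.cons t.1 t.2.1 : Fin (d + 1) → Bool) (Fin.last d)) else 0 := by
    intro t
    have h0 : (.inl 0 ∈ twoHubSets d γ t) ↔ t.1 := by simp [mem_twoHubSets_inl]
    cases ht : t.1 with
    | false => simp [h0, ht]
    | true =>
      have h0' := h0.2 ht
      simp only [h0', true_and, if_true]
      rw [← ite_zero_mul, (twoHub_isRooting d γ σ).prod_weight h0', Fintype.prod_sum_type,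
        Fin.prod_univ_succ, Fintype.prod_sigma]
      congr 1
      · rw [mul_assoc, mul_assoc]
        congr 1
        congr 1
        · refine prod_congr rfl fun j _ => ?_
          have : twoHubPar d γ σ (.inl j.succ) = some (.inl j.castSucc) := by
            simp [twoHubPar, Fin.ext_iff]
          simp [this, mem_twoHubSets_inl, ht]
        · refine prod_congr rfl fun i _ => prod_congr rfl fun j _ => ?_
          rw [cons_castSucc]
          simp only [twoHubPar, Option.elim_some, mem_twoHubSets_inr, Bool.decide_eq_true]
          congr 1
          by_cases hj : j.1 = 0 <;> cases hσ : σ i <;>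
            simp [hj, mem_twoHubSets_inl, mem_twoHubSets_inr, ht]
      · simp [mem_twoHubSets_inl, ht]
  rw [sum_filter, ← (twoHubSets d γ).sum_comp]
  simp only [hsummand, Fintype.sum_prod_type, Fintype.sum_bool, if_true, Bool.false_eq_true,
    if_false, sum_const_zero, add_zero]
  have hlegs : ∀ b : ι → Bool, ∑ H : (i : ι) → Fin (γ i) → Bool,
      ∏ i, chainWeight y z (b i) (H i) = ∏ i, if b i then legSum y z (γ i) else 1 := by
    intro b
    simp only [← sum_chainWeight_eq_legSum, prod_univ_sum, Fintype.piFinset_univ]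
  simp only [← mul_sum, ← sum_mul, hlegs]
  have := sum_chainWeight y z d true fun c => (∏ i, if (if σ i then true else c) then
    legSum y z (γ i) else 1) * ψ c
  simp only [mul_assoc, ← mul_sum]
  rw [this]
  simp [prod_filter, mul_assoc]

theorem sum_subtree_other_hub (d : ℕ) (γ : ι → ℕ) (σ : ι → Bool) (y z : R) :
    ∑ A with (.inl 0 ∉ A ∧ .inl (Fin.last d) ∈ A) ∧ IsSubtree (twoHub d γ σ) A,
        y ^ cut (twoHub d γ σ) A * z ^ #A =
      z * (y * (∑ j ∈ range d, z ^ j) * ∏ i with ¬ σ i, legSum y z (γ i)) := by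
  have := sum_subtree_hub d γ (fun i => !σ i) y z fun b => if b then 0 else 1
  simp only [if_true, Bool.false_eq_true, if_false, mul_zero, mul_one, zero_add, Bool.not_eq_true',
    ← Bool.not_eq_true, decide_eq_true_eq, mul_ite, ← ite_not (p := _ ∈ _)] at this
  rw [← this, ← sum_filter, filter_filter, sum_filter, sum_filter]
  refine Fintype.sum_equiv (twoHubFlip d γ σ).toEquiv.finsetCongr _ _ fun A => ?_
  rw [Equiv.finsetCongr_apply, isSubtree_map, cut_map, card_map]
  have hm : ∀ x : Fin (d + 1), .inl x ∈ A.map (twoHubFlip d γ σ).toEquiv.toEmbedding ↔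
      .inl x.rev ∈ A := by
    intro x
    rw [mem_map_equiv]
    exact Iff.rfl
  refine if_congr ?_ rfl rfl
  rw [hm, hm, Fin.rev_zero, Fin.rev_last]
  tauto

theorem sum_subtree_no_hub (d : ℕ) (γ : ι → ℕ) (σ σ' : ι → Bool) (y z : R) :
    ∑ A with (.inl 0 ∉ A ∧ .inl (Fin.last d) ∉ A) ∧ IsSubtree (twoHub d γ σ) A,
        y ^ cut (twoHub d γ σ) A * z ^ #A =
      ∑ A with (.inl 0 ∉ A ∧ .inl (Fin.last d) ∉ A) ∧ IsSubtree (twoHub d γ σ') A,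
        y ^ cut (twoHub d γ σ') A * z ^ #A := by
  rw [sum_filter, sum_filter]
  refine sum_congr rfl fun A _ => ?_
  by_cases hA : .inl 0 ∉ A ∧ .inl (Fin.last d) ∉ A
  swap
  · rw [if_neg fun h => hA h.1, if_neg fun h => hA h.1]
  obtain ⟨h0, hd⟩ := hA
  have h1 : ∀ x, (∃ p ∈ A, twoHubPar d γ σ x = some p) ↔
      ∃ p ∈ A, twoHubPar d γ σ' x = some p := by
    rintro (k | ⟨i, j⟩)
    · rfl
    · by_cases hj : j.1 = 0 <;> cases hσ : σ i <;> cases hσ' : σ' i <;>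
        simp [twoHubPar, hj, h0, hd, hσ, hσ']
  have h2 : ∀ x, (∃ p ∉ A, twoHubPar d γ σ x = some p) ↔
      ∃ p ∉ A, twoHubPar d γ σ' x = some p := by
    rintro (k | ⟨i, j⟩)
    · rfl
    · by_cases hj : j.1 = 0 <;> cases hσ : σ i <;> cases hσ' : σ' i <;>
        simp [twoHubPar, hj, h0, hd, hσ, hσ']
  simp only [(twoHub_isRooting d γ _).isSubtree_iff, cut, (twoHub_isRooting d γ _).arcs_eq,
    mem_compl, h1, h2]
  congr

theorem subtreeSum_twoHub (d : ℕ) (γ : ι → ℕ) (σ : ι → Bool) (y z : R) :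
    subtreeSum (twoHub d γ σ) y z = z ^ (d + 1) * ∏ i, legSum y z (γ i) +
      z * (∑ j ∈ range d, z ^ j) * y *
        (∏ i with σ i, legSum y z (γ i) + ∏ i with ¬ σ i, legSum y z (γ i)) +
      ∑ A with (.inl 0 ∉ A ∧ .inl (Fin.last d) ∉ A) ∧ IsSubtree (twoHub d γ σ) A,
        y ^ cut (twoHub d γ σ) A * z ^ #A := by
  have h0 := sum_subtree_hub d γ σ y z fun _ => 1
  have hd := sum_subtree_other_hub d γ σ y z
  simp only [mul_one] at h0
  have hsplit : subtreeSum (twoHub d γ σ) y z =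
      ∑ A with .inl 0 ∈ A ∧ IsSubtree (twoHub d γ σ) A, y ^ cut (twoHub d γ σ) A * z ^ #A +
      ∑ A with (.inl 0 ∉ A ∧ .inl (Fin.last d) ∈ A) ∧ IsSubtree (twoHub d γ σ) A,
        y ^ cut (twoHub d γ σ) A * z ^ #A +
      ∑ A with (.inl 0 ∉ A ∧ .inl (Fin.last d) ∉ A) ∧ IsSubtree (twoHub d γ σ) A,
        y ^ cut (twoHub d γ σ) A * z ^ #A := by
    rw [subtreeSum]
    simp only [sum_filter]
    rw [← sum_add_distrib, ← sum_add_distrib]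
    refine sum_congr rfl fun A _ => ?_
    by_cases h1 : .inl 0 ∈ A <;> by_cases h2 : .inl (Fin.last d) ∈ A <;> simp [h1, h2]
  rw [hsplit, h0, hd]
  ring

end TwoHub

section Multisets

open Finset Polynomial
open scoped Classical

theorem mem_of_prod_X_pow_sub_one_eq {M N : Multiset ℕ} {m : ℕ} (hm : m ∈ M)
    (hN : ∀ n ∈ N, 0 < n ∧ n ≤ m)
    (h : (M.map fun n => (X : ℤ[X]) ^ n - 1).prod = (N.map fun n => (X : ℤ[X]) ^ n - 1).prod) :
    m ∈ N := by
  rcases eq_or_ne m 0 with rfl | hm0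
  · have : (N.map fun n => (X : ℤ[X]) ^ n - 1).prod = 0 := by
      rw [← h]
      exact Multiset.prod_eq_zero (Multiset.mem_map.2 ⟨0, hm, by simp⟩)
    obtain ⟨n, hn, -⟩ := Multiset.mem_map.1 (Multiset.prod_eq_zero_iff.1 this)
    obtain rfl : n = 0 := by have := (hN n hn).2; omega
    exact hn
  · have hζ := Complex.isPrimitiveRoot_exp m hm0
    set ζ := Complex.exp (2 * Real.pi * Complex.I / m)
    have := congrArg (aeval ζ) h
    simp only [map_multiset_prod, Multiset.map_map, Function.comp_def, map_sub, map_pow, aeval_X,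
      map_one] at this
    rw [Multiset.prod_eq_zero (Multiset.mem_map.2 ⟨m, hm, by simp [hζ.pow_eq_one]⟩), eq_comm,
      Multiset.prod_eq_zero_iff] at this
    obtain ⟨n, hn, h0⟩ := Multiset.mem_map.1 this
    have hdvd := hζ.dvd_of_pow_eq_one n (sub_eq_zero.1 h0)
    have := Nat.le_of_dvd (hN n hn).1 hdvd
    rwa [le_antisymm this (hN n hn).2]

theorem eq_of_prod_X_pow_sub_one_eq {M N : Multiset ℕ} (hM : ∀ n ∈ M, 0 < n) (hN : ∀ n ∈ N, 0 < n)
    (h : (M.map fun n => (X : ℤ[X]) ^ n - 1).prod = (N.map fun n => (X : ℤ[X]) ^ n - 1).prod) :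
    M = N := by
  induction hk : M.card generalizing M N with
  | zero =>
    rw [Multiset.card_eq_zero] at hk
    subst hk
    by_contra hne
    obtain ⟨n, hn⟩ := Multiset.exists_mem_of_ne_zero (Ne.symm hne)
    have := congrArg (eval 1) h
    rw [eval_multiset_prod, eval_multiset_prod, Multiset.map_map, Multiset.map_map,
      Multiset.prod_eq_zero (s := N.map _) (Multiset.mem_map.2 ⟨n, hn, by simp⟩)] at this
    simp at this
  | succ k ih =>
    have hne : (M + N).toFinset.Nonempty := by
      rw [Multiset.toFinset_nonempty]
      intro h0
      have := congrArg Multiset.card h0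
      rw [Multiset.card_add, hk, Multiset.card_zero] at this
      omega
    obtain ⟨m, hm, hmax⟩ := exists_max_image _ id hne
    simp only [Multiset.mem_toFinset, Multiset.mem_add, id] at hm hmax
    have hmM : m ∈ M := hm.elim id fun hm =>
      mem_of_prod_X_pow_sub_one_eq hm (fun n hn => ⟨hM n hn, hmax n (Or.inl hn)⟩) h.symm
    have hmN : m ∈ N := hm.elim (fun hm =>
      mem_of_prod_X_pow_sub_one_eq hm (fun n hn => ⟨hN n hn, hmax n (Or.inr hn)⟩) h) id
    obtain ⟨M, rfl⟩ := Multiset.exists_cons_of_mem hmM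
    obtain ⟨N, rfl⟩ := Multiset.exists_cons_of_mem hmN
    simp only [Multiset.map_cons, Multiset.prod_cons] at h
    rw [ih (fun n hn => hM n (Multiset.mem_cons_of_mem hn))
      (fun n hn => hN n (Multiset.mem_cons_of_mem hn))
      (mul_left_cancel₀ (X_pow_sub_C_ne_zero (hM m hmM) 1) h) (by simpa using hk)]

theorem le_of_X_pow_mul_prod_eq {M N : Multiset ℕ} (hM : ∀ n ∈ M, 0 < n) {a b : ℕ}
    (h : (X : ℤ[X]) ^ a * (M.map fun n => (X : ℤ[X]) ^ n - 1).prod =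
      X ^ b * (N.map fun n => (X : ℤ[X]) ^ n - 1).prod) : b ≤ a := by
  by_contra! hab
  obtain ⟨c, rfl⟩ := Nat.exists_eq_add_of_lt hab
  rw [add_assoc, pow_add, mul_assoc] at h
  have := congrArg (eval 0) (mul_left_cancel₀ (pow_ne_zero a X_ne_zero) h)
  rw [eval_mul, eval_pow, eval_X, zero_pow (Nat.succ_ne_zero c), zero_mul, eval_multiset_prod,
    Multiset.map_map, Multiset.prod_eq_zero_iff, Multiset.mem_map] at this
  obtain ⟨n, hn, h0⟩ := this
  simp [(hM n hn).ne'] at h0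

variable {ι κ : Type*}

theorem prod_geom_sum_mul (S : Finset ι) (γ : ι → ℕ) :
    (∏ i ∈ S, ∑ j ∈ range (γ i), (X : ℤ[X]) ^ j) * (X - 1) ^ #S =
      ((S.val.map γ).map fun n => (X : ℤ[X]) ^ n - 1).prod := by
  rw [← prod_const, ← prod_mul_distrib, Multiset.map_map]
  exact prod_congr rfl fun i _ => geom_sum_mul X (γ i)

theorem eq_of_X_pow_mul_prod_geom_sum_eq {S : Finset ι} {T : Finset κ} {γ : ι → ℕ} {γ' : κ → ℕ}
    (hγ : ∀ i, 0 < γ i) (hγ' : ∀ i, 0 < γ' i) (hST : #S = #T) {a b : ℕ}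
    (h : X ^ a * ∏ i ∈ S, ∑ j ∈ range (γ i), (X : ℤ[X]) ^ j =
      X ^ b * ∏ i ∈ T, ∑ j ∈ range (γ' i), (X : ℤ[X]) ^ j) :
    a = b ∧ S.val.map γ = T.val.map γ' := by
  have hS : ∀ n ∈ S.val.map γ, 0 < n := by simpa using fun i _ => hγ i
  have hT : ∀ n ∈ T.val.map γ', 0 < n := by simpa using fun i _ => hγ' i
  have h' := congrArg (· * (X - 1 : ℤ[X]) ^ #S) h
  simp only [mul_assoc, prod_geom_sum_mul] at h'
  rw [hST, prod_geom_sum_mul] at h'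
  obtain rfl := le_antisymm (le_of_X_pow_mul_prod_eq hT h'.symm) (le_of_X_pow_mul_prod_eq hS h')
  exact ⟨rfl, eq_of_prod_X_pow_sub_one_eq hS hT (mul_left_cancel₀ (pow_ne_zero a X_ne_zero) h')⟩

theorem exists_equiv_of_map_eq [Fintype ι] [Fintype κ] {α : Type*} {f : ι → α} {g : κ → α}
    (h : (univ : Finset ι).val.map f = (univ : Finset κ).val.map g) :
    ∃ e : ι ≃ κ, ∀ i, g (e i) = f i := by
  have : ∀ a, Nonempty ({i // f i = a} ≃ {i // g i = a}) := by
    intro a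
    have := congrArg (Multiset.count a) h
    rw [Multiset.count_map, Multiset.count_map, ← filter_val, ← filter_val, card_val,
      card_val] at this
    refine ⟨Fintype.equivOfCardEq ?_⟩
    rw [Fintype.card_subtype, Fintype.card_subtype]
    simpa only [eq_comm] using this
  obtain ⟨E⟩ := Classical.nonempty_pi.2 this
  refine ⟨(Equiv.sigmaFiberEquiv f).symm.trans
    ((Equiv.sigmaCongrRight E).trans (Equiv.sigmaFiberEquiv g)), fun i => ?_⟩
  exact (E (f i) ⟨i, rfl⟩).2

theorem exists_equiv_of_map_filter_eq [Fintype ι] [Fintype κ] {γ : ι → ℕ} {γ' : κ → ℕ}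
    {σ : ι → Bool} {σ' : κ → Bool}
    (h : (univ : Finset ι).val.map γ = (univ : Finset κ).val.map γ')
    (h' : (univ.filter fun i => σ i = true).val.map γ =
      (univ.filter fun i => σ' i = true).val.map γ') :
    ∃ e : ι ≃ κ, ∀ i, γ' (e i) = γ i ∧ σ' (e i) = σ i := by
  suffices hp : (univ : Finset ι).val.map (fun i => (γ i, σ i)) =
      (univ : Finset κ).val.map fun i => (γ' i, σ' i) by
    obtain ⟨e, he⟩ := exists_equiv_of_map_eq hp
    exact ⟨e, fun i => by simpa using he i⟩
  ext ⟨n, b⟩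
  have h1 := congrArg (Multiset.count n) h
  have h2 := congrArg (Multiset.count n) h'
  simp only [Multiset.count_map, ← filter_val, card_val, filter_filter, Prod.mk.injEq] at h1 h2 ⊢
  cases b with
  | true => simpa only [and_comm, eq_comm] using h2
  | false =>
    have hb : ∀ b : Bool, false = b ↔ ¬ true = b := by decide
    have e1 := card_filter_add_card_filter_not (s := {i | n = γ i}) (fun i => true = σ i)
    have e2 := card_filter_add_card_filter_not (s := {i | n = γ' i}) (fun i => true = σ' i)
    simp only [filter_filter, and_comm, eq_comm (b := true), hb] at *
    omega

end Multisets

section Recovery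

open Finset Polynomial
open scoped Classical

variable {ι κ : Type*}

theorem natDegree_legSum_le (n : ℕ) : (legSum X (C X) n : ℤ[X][X]).natDegree ≤ 1 := by
  rw [legSum, ← map_pow]
  simp only [← map_pow, ← map_sum]
  compute_degree

theorem coeff_legSum (n : ℕ) :
    (legSum X (C X) n : ℤ[X][X]).coeff 1 = ∑ j ∈ range n, (X : ℤ[X]) ^ j := by
  simp only [legSum, ← map_pow, ← map_sum, coeff_add, coeff_C_succ, zero_add]
  rw [coeff_mul_C, coeff_X_one, one_mul]

theorem natDegree_prod_legSum_le (S : Finset ι) (γ : ι → ℕ) :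
    (∏ i ∈ S, legSum X (C X) (γ i) : ℤ[X][X]).natDegree ≤ #S := by
  refine (natDegree_prod_le _ _).trans ?_
  simpa using sum_le_card_nsmul S _ 1 fun i _ => natDegree_legSum_le (γ i)

theorem coeff_prod_legSum (S : Finset ι) (γ : ι → ℕ) :
    (∏ i ∈ S, legSum X (C X) (γ i) : ℤ[X][X]).coeff #S =
      ∏ i ∈ S, ∑ j ∈ range (γ i), (X : ℤ[X]) ^ j := by
  have := coeff_prod_of_natDegree_le S (fun i => (legSum X (C X) (γ i) : ℤ[X][X])) 1
    fun i _ => natDegree_legSum_le (γ i)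
  simpa [coeff_legSum] using this

theorem geom_sum_X_ne_zero {n : ℕ} (hn : 0 < n) : ∑ j ∈ range n, (X : ℤ[X]) ^ j ≠ 0 := by
  intro h
  have := congrArg (eval 1) h
  simp only [eval_finsetSum, eval_pow, eval_X, one_pow, sum_const, card_range, eval_zero] at this
  simp [hn.ne'] at this

theorem natDegree_prod_legSum (S : Finset ι) {γ : ι → ℕ} (hγ : ∀ i, 0 < γ i) :
    (∏ i ∈ S, legSum X (C X) (γ i) : ℤ[X][X]).natDegree = #S := by
  refine natDegree_eq_of_le_of_coeff_ne_zero (natDegree_prod_legSum_le S γ) ?_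
  rw [coeff_prod_legSum]
  exact prod_ne_zero_iff.2 fun i _ => geom_sum_X_ne_zero (hγ i)

end Recovery

section Recovery

open Finset Polynomial
open scoped Classical

variable {ι κ : Type*} [Fintype ι] [Fintype κ]

/-- Both ends of the path are branch vertices, and the hanging paths are not empty. -/
structure IsProperTwoHub (d : ℕ) (γ : ι → ℕ) (σ : ι → Bool) : Prop where
  length_pos : 0 < d
  leg_pos : ∀ i, 0 < γ i
  two_le_card : 2 ≤ #{i | σ i}
  two_le_card_not : 2 ≤ #{i | ¬ σ i}
  deg_le : ∀ x, x ≠ .inl 0 → x ≠ .inl (Fin.last d) → deg (twoHub d γ σ) x ≤ 2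

namespace IsProperTwoHub

variable {d d' : ℕ} {γ : ι → ℕ} {σ : ι → Bool} {γ' : κ → ℕ} {σ' : κ → Bool}

theorem natDegree_no_hub_le (h : IsProperTwoHub d γ σ) :
    (∑ A with (.inl 0 ∉ A ∧ .inl (Fin.last d) ∉ A) ∧ IsSubtree (twoHub d γ σ) A,
      X ^ cut (twoHub d γ σ) A * C X ^ #A : ℤ[X][X]).natDegree ≤ 2 := by
  refine natDegree_sum_le_of_forall_le _ _ fun A hA => ?_
  obtain ⟨⟨h0, hd⟩, hA⟩ := (mem_filter.1 hA).2
  have hcut := (twoHub_isRooting d γ σ).cut_add hA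
  have hdeg : ∑ x ∈ A, deg (twoHub d γ σ) x ≤ #A • 2 := by
    refine sum_le_card_nsmul _ _ _ fun x hx => h.deg_le x ?_ ?_
    · rintro rfl
      exact h0 hx
    · rintro rfl
      exact hd hx
  rw [← map_pow]
  refine (natDegree_mul_C_le _ _).trans ((natDegree_X_pow_le _).trans ?_)
  rw [smul_eq_mul] at hdeg
  omega

theorem coeff_subtreeSum (h : IsProperTwoHub d γ σ) {n : ℕ} (hn : Fintype.card ι ≤ n) :
    (subtreeSum (twoHub d γ σ) X (C X) : ℤ[X][X]).coeff n =
      X ^ (d + 1) * (∏ i, legSum (X : ℤ[X][X]) (C X) (γ i) : ℤ[X][X]).coeff n := by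
  have hcard := card_filter_add_card_filter_not (s := (univ : Finset ι)) (fun i => σ i = true)
  rw [card_univ] at hcard
  have h1 := h.two_le_card
  have h2 := h.two_le_card_not
  rw [subtreeSum_twoHub, coeff_add, coeff_add,
    coeff_eq_zero_of_natDegree_lt (h.natDegree_no_hub_le.trans_lt (by omega)),
    coeff_eq_zero_of_natDegree_lt (n := n) (p := C X * _ * X * _), add_zero, add_zero, ← map_pow,
    coeff_C_mul]
  have hα := natDegree_prod_legSum_le {i | σ i} γ
  have hβ := natDegree_prod_legSum_le {i | ¬ σ i} γ
  simp only [← map_pow, ← map_sum, ← map_mul, mul_assoc]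
  have e1 := natDegree_C_mul_le (X * ∑ j ∈ range d, X ^ j : ℤ[X])
    (X * (∏ i with σ i, legSum (X : ℤ[X][X]) (C X) (γ i) +
      ∏ i with ¬ σ i, legSum (X : ℤ[X][X]) (C X) (γ i)))
  have e2 := natDegree_mul_le (p := (X : ℤ[X][X]))
    (q := ∏ i with σ i, legSum (X : ℤ[X][X]) (C X) (γ i) +
      ∏ i with ¬ σ i, legSum (X : ℤ[X][X]) (C X) (γ i))
  have e3 := natDegree_add_le (∏ i with σ i, legSum (X : ℤ[X][X]) (C X) (γ i))
    (∏ i with ¬ σ i, legSum (X : ℤ[X][X]) (C X) (γ i))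
  rw [natDegree_X] at e2
  simp only [map_mul, mul_assoc, map_pow, map_sum] at e1 ⊢
  omega

theorem coeff_card_subtreeSum (h : IsProperTwoHub d γ σ) :
    (subtreeSum (twoHub d γ σ) X (C X) : ℤ[X][X]).coeff (Fintype.card ι) =
      X ^ (d + 1) * ∏ i, ∑ j ∈ range (γ i), (X : ℤ[X]) ^ j := by
  rw [h.coeff_subtreeSum le_rfl, ← coeff_prod_legSum, card_univ]

theorem natDegree_subtreeSum (h : IsProperTwoHub d γ σ) :
    (subtreeSum (twoHub d γ σ) X (C X) : ℤ[X][X]).natDegree = Fintype.card ι := by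
  refine natDegree_eq_of_le_of_coeff_ne_zero (natDegree_le_iff_coeff_eq_zero.2 fun n hn => ?_) ?_
  · rw [h.coeff_subtreeSum hn.le, coeff_eq_zero_of_natDegree_lt, mul_zero]
    exact (natDegree_prod_legSum_le _ _).trans_lt (by rwa [card_univ])
  · rw [h.coeff_card_subtreeSum]
    exact mul_ne_zero (pow_ne_zero _ X_ne_zero)
      (prod_ne_zero_iff.2 fun i _ => geom_sum_X_ne_zero (h.leg_pos i))

end IsProperTwoHub

theorem twoHub_iso_of_prod_legSum_eq {d : ℕ} {γ : ι → ℕ} {σ τ : ι → Bool} (hγ : ∀ i, 0 < γ i)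
    (h : ∏ i with σ i, legSum (X : ℤ[X][X]) (C X) (γ i) =
      ∏ i with τ i, legSum (X : ℤ[X][X]) (C X) (γ i)) :
    Nonempty (twoHub d γ σ ≃g twoHub d γ τ) := by
  have hcard : #{i | σ i} = #{i | τ i} := by
    rw [← natDegree_prod_legSum _ hγ, h, natDegree_prod_legSum _ hγ]
  have hcoeff := congrArg (coeff · #{i | σ i}) h
  simp only [coeff_prod_legSum] at hcoeff
  rw [hcard, coeff_prod_legSum] at hcoeff
  have hmap := (eq_of_X_pow_mul_prod_geom_sum_eq (a := 0) (b := 0) hγ hγ hcard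
    (by rw [pow_zero, one_mul, one_mul, hcoeff])).2
  obtain ⟨e, he⟩ := exists_equiv_of_map_filter_eq rfl hmap
  exact twoHub_iso_of_equiv d e (fun i => (he i).1) fun i => (he i).2

theorem twoHub_iso_of_subtreeSum_eq_of_same_legs {d : ℕ} {γ : ι → ℕ} {σ τ : ι → Bool} (hd : 0 < d)
    (hγ : ∀ i, 0 < γ i)
    (h : subtreeSum (twoHub d γ σ) (X : ℤ[X][X]) (C X) =
      subtreeSum (twoHub d γ τ) (X : ℤ[X][X]) (C X)) :
    Nonempty (twoHub d γ σ ≃g twoHub d γ τ) := by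
  rw [subtreeSum_twoHub, subtreeSum_twoHub, sum_subtree_no_hub d γ σ τ, add_left_inj,
    add_right_inj] at h
  have hC : (C X * (∑ j ∈ range d, C X ^ j) * X : ℤ[X][X]) ≠ 0 := by
    refine mul_ne_zero (mul_ne_zero (C_ne_zero.2 X_ne_zero) ?_) X_ne_zero
    simp only [← map_pow, ← map_sum]
    exact C_ne_zero.2 (geom_sum_X_ne_zero hd)
  have hadd := mul_left_cancel₀ hC h
  have hmul : ∀ ρ : ι → Bool, (∏ i with ρ i, legSum (X : ℤ[X][X]) (C X) (γ i)) *
      ∏ i with ¬ ρ i, legSum (X : ℤ[X][X]) (C X) (γ i) =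
      ∏ i, legSum (X : ℤ[X][X]) (C X) (γ i) := fun ρ =>
    prod_filter_mul_prod_filter_not _ _ _
  have hzero : (∏ i with σ i, legSum (X : ℤ[X][X]) (C X) (γ i) -
        ∏ i with τ i, legSum (X : ℤ[X][X]) (C X) (γ i)) *
      (∏ i with σ i, legSum (X : ℤ[X][X]) (C X) (γ i) -
        ∏ i with ¬ τ i, legSum (X : ℤ[X][X]) (C X) (γ i)) = 0 := by
    linear_combination (∏ i with σ i, legSum (X : ℤ[X][X]) (C X) (γ i)) * hadd - hmul σ + hmul τ
  rcases mul_eq_zero.1 hzero with h0 | h0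
  · exact twoHub_iso_of_prod_legSum_eq hγ (sub_eq_zero.1 h0)
  · obtain ⟨f⟩ := twoHub_iso_of_prod_legSum_eq (d := d) (σ := σ) (τ := fun i => !τ i) hγ
      (by simpa using sub_eq_zero.1 h0)
    exact ⟨f.trans (twoHubFlip d γ τ).symm⟩

theorem twoHub_iso_of_subtreeSum_eq {d d' : ℕ} {γ : ι → ℕ} {σ : ι → Bool} {γ' : κ → ℕ}
    {σ' : κ → Bool} (h : IsProperTwoHub d γ σ) (h' : IsProperTwoHub d' γ' σ')
    (heq : subtreeSum (twoHub d γ σ) (X : ℤ[X][X]) (C X) =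
      subtreeSum (twoHub d' γ' σ') (X : ℤ[X][X]) (C X)) :
    Nonempty (twoHub d γ σ ≃g twoHub d' γ' σ') := by
  have hcard : Fintype.card ι = Fintype.card κ := by
    rw [← h.natDegree_subtreeSum, heq, h'.natDegree_subtreeSum]
  have hcoeff := h.coeff_card_subtreeSum
  rw [heq, hcard, h'.coeff_card_subtreeSum] at hcoeff
  obtain ⟨hd, hmap⟩ := eq_of_X_pow_mul_prod_geom_sum_eq h.leg_pos h'.leg_pos
    (by rwa [card_univ, card_univ]) hcoeff.symm
  obtain rfl : d = d' := by omega
  obtain ⟨e, he⟩ := exists_equiv_of_map_eq hmap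
  obtain ⟨f⟩ := twoHub_iso_of_equiv d (σ := fun i => σ' (e i)) e he fun _ => rfl
  rw [← subtreeSum_map f] at heq
  obtain ⟨g⟩ := twoHub_iso_of_subtreeSum_eq_of_same_legs h.length_pos h.leg_pos heq
  exact ⟨g.trans f⟩

end Recovery

section Recognition

open Finset
open scoped Classical

theorem deg_eq_card {V : Type*} [Fintype V] (G : SimpleGraph V) (x : V) :
    deg G x = #{y | G.Adj x y} := by
  rw [deg, Nat.card_eq_fintype_card, Fintype.card_subtype]
  rfl

theorem deg_map {V W : Type*} {F : SimpleGraph V} {G : SimpleGraph W} (f : F ≃g G) (x : V) :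
    deg G (f x) = deg F x :=
  (Nat.card_congr (f.toEquiv.subtypeEquiv fun _ => f.map_adj_iff.symm)).symm

theorem eq_or_eq_or_eq_of_deg_le_two {V : Type*} [Fintype V] {G : SimpleGraph V} {x a b c : V}
    (h : deg G x ≤ 2) (ha : G.Adj x a) (hb : G.Adj x b) (hc : G.Adj x c) :
    a = b ∨ a = c ∨ b = c := by
  by_contra! hne
  rw [deg_eq_card] at h
  exact h.not_gt (two_lt_card.2 ⟨a, by simpa, b, by simpa, c, by simpa, hne⟩)

/-- Being `v` or one of its ancestors. -/
def OnTrunk {V : Type*} (par : V → Option V) (v : V) : V → Prop :=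
  Relation.ReflTransGen (fun a b => par a = some b) v

namespace IsRooting

variable {V : Type*} {G : SimpleGraph V} {par : V → Option V} {dep : V → ℕ} {r : V}

theorem adj_of_par (h : IsRooting G par dep r) {x y : V} (hxy : par x = some y) : G.Adj x y :=
  (h.adj_iff x y).2 (.inl hxy)

theorem exists_par (h : IsRooting G par dep r) {x : V} (hx : x ≠ r) : ∃ y, par x = some y :=
  Option.ne_none_iff_exists'.1 (mt (h.root_iff x).1 hx)

theorem eq_root (h : IsRooting G par dep r) {x : V} (hx : dep x = 0) : x = r := by
  by_contra hr
  obtain ⟨y, hy⟩ := h.exists_par hr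
  have := h.dep_eq x y hy
  omega

theorem eq_of_par_eq_of_deg_le_two [Fintype V] (h : IsRooting G par dep r) {p x y : V}
    (hp : p ≠ r) (hdeg : deg G p ≤ 2) (hx : par x = some p) (hy : par y = some p) : x = y := by
  obtain ⟨q, hq⟩ := h.exists_par hp
  have h1 := h.dep_eq _ _ hq
  have h2 := h.dep_eq _ _ hx
  have h3 := h.dep_eq _ _ hy
  rcases eq_or_eq_or_eq_of_deg_le_two hdeg (h.adj_of_par hx).symm (h.adj_of_par hy).symm
    (h.adj_of_par hq) with rfl | rfl | rfl
  · rfl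
  · omega
  · omega

theorem injective_of_par_map (h : IsRooting G par dep r) {W : Type*} {par' : W → Option W}
    {φ : V → W} (hφ : ∀ x, par' (φ x) = (par x).map φ)
    (hsib : ∀ p x y, par x = some p → par y = some p → φ x = φ y → x = y) :
    Function.Injective φ := by
  intro x y hxy
  induction hn : dep x generalizing x y with
  | zero =>
    obtain rfl := h.eq_root hn
    have := hφ y
    rw [← hxy, hφ, (h.root_iff x).2 rfl, Option.map_none, eq_comm, Option.map_eq_none_iff,
      h.root_iff] at this
    exact this.symm
  | succ n ih =>
    obtain ⟨p, hp⟩ := h.exists_par (x := x) fun hx => by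
      rw [hx, h.dep_root] at hn
      omega
    have := hφ y
    rw [← hxy, hφ, hp, Option.map_some, eq_comm, Option.map_eq_some_iff] at this
    obtain ⟨q, hq, hpq⟩ := this
    obtain rfl := ih hpq.symm (by have := h.dep_eq x p hp; omega)
    exact hsib p x y hp hq hxy

theorem exists_leg (h : IsRooting G par dep r) (S : V → Prop) :
    ∃ (leg : V → V) (pos : V → ℕ), ∀ x y, par x = some y →
      (S y → leg x = x ∧ pos x = 0) ∧ (¬ S y → leg x = leg y ∧ pos x = pos y + 1) := by
  let L : ℕ → V → V × ℕ := Nat.rec (fun x => (x, 0)) fun _ l x =>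
    (par x).elim (x, 0) fun y => if S y then (x, 0) else ((l y).1, (l y).2 + 1)
  refine ⟨fun x => (L (dep x) x).1, fun x => (L (dep x) x).2, fun x y hxy => ?_⟩
  simp only [h.dep_eq x y hxy]
  have : L (dep y + 1) x =
      if S y then (x, 0) else ((L (dep y) y).1, (L (dep y) y).2 + 1) := by
    simp only [L, hxy, Option.elim]
  rw [this]
  constructor <;> intro hy <;> simp [hy]

variable {v : V}

theorem trunk_dep_le (h : IsRooting G par dep r) {x : V} (hx : OnTrunk par v x) :
    dep x ≤ dep v := by
  induction hx with
  | refl => rfl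
  | tail _ hab ih =>
    have := h.dep_eq _ _ hab
    omega

theorem trunk_dep_injOn (h : IsRooting G par dep r) {x y : V} (hx : OnTrunk par v x)
    (hy : OnTrunk par v y) (hxy : dep x = dep y) : x = y := by
  have key : ∀ {x y}, OnTrunk par x y → dep x = dep y → x = y := by
    intro x y hxy hdep
    rcases Relation.ReflTransGen.cases_head hxy with rfl | ⟨z, hz, hzy⟩
    · rfl
    · have h1 := h.dep_eq _ _ hz
      have h2 := h.trunk_dep_le hzy
      omega
  rcases Relation.ReflTransGen.total_of_right_unique
    (fun a b c hb hc => Option.some_injective _ (hb.symm.trans hc)) hx hy with H | H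
  · exact key H hxy
  · exact (key H hxy.symm).symm

theorem exists_trunk_dep (h : IsRooting G par dep r) {k : ℕ} (hk : k ≤ dep v) :
    ∃ x, OnTrunk par v x ∧ dep x = k := by
  induction hk using Nat.decreasingInduction with
  | self => exact ⟨v, .refl, rfl⟩
  | of_succ k hk ih =>
    obtain ⟨x, hx, hdep⟩ := ih
    obtain ⟨y, hy⟩ := h.exists_par (x := x) fun hr => by
      rw [hr, h.dep_root] at hdep
      omega
    have := h.dep_eq _ _ hy
    exact ⟨y, hx.tail hy, by omega⟩

theorem trunk_root (h : IsRooting G par dep r) : OnTrunk par v r := by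
  obtain ⟨x, hx, hdep⟩ := h.exists_trunk_dep (v := v) (Nat.zero_le _)
  exact h.eq_root hdep ▸ hx

theorem eq_root_or_eq_of_par_mem_trunk [Fintype V] (h : IsRooting G par dep r)
    (hdeg : ∀ x, x ≠ r → x ≠ v → deg G x ≤ 2) {x y : V} (hx : ¬ OnTrunk par v x)
    (hy : OnTrunk par v y) (hxy : par x = some y) : y = r ∨ y = v := by
  by_contra! hne
  rcases Relation.ReflTransGen.cases_tail hy with rfl | ⟨z, hz, hzy⟩
  · exact hne.2 rfl
  · obtain rfl := h.eq_of_par_eq_of_deg_le_two hne.1 (hdeg y hne.1 hne.2) hxy hzy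
    exact hx hz

theorem two_le_card_children [Fintype V] (h : IsRooting G par dep r) {b : V}
    (hdeg : 3 ≤ deg G b) (hb : OnTrunk par v b)
    (hdep : ∀ x y, OnTrunk par v x → OnTrunk par v y → G.Adj b x → G.Adj b y → dep x = dep y) :
    2 ≤ #{x | ¬ OnTrunk par v x ∧ par x = some b} := by
  rw [deg_eq_card, ← card_filter_add_card_filter_not (OnTrunk par v)] at hdeg
  have h1 : #(filter (OnTrunk par v) {y | G.Adj b y}) ≤ 1 := by
    rw [card_le_one]
    intro x hx y hy
    simp only [mem_filter, mem_univ, true_and] at hx hy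
    exact h.trunk_dep_injOn hx.2 hy.2 (hdep x y hx.2 hy.2 hx.1 hy.1)
  have h2 : #({y ∈ {y | G.Adj b y} | ¬ OnTrunk par v y} : Finset V) ≤
      #{x | ¬ OnTrunk par v x ∧ par x = some b} := by
    refine card_le_card fun x hx => ?_
    simp only [mem_filter, mem_univ, true_and] at hx ⊢
    refine ⟨hx.2, ((h.adj_iff b x).1 hx.1).resolve_left fun hbx => hx.2 (hb.tail hbx)⟩
  omega

end IsRooting

theorem sigma_fin_eq_iff {ι : Type*} {γ : ι → ℕ} {i i' : ι} {j : Fin (γ i)} {j' : Fin (γ i')} :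
    (⟨i, j⟩ : Σ i, Fin (γ i)) = ⟨i', j'⟩ ↔ i = i' ∧ j.1 = j'.1 := by
  constructor
  · rintro ⟨⟩
    exact ⟨rfl, rfl⟩
  · rintro ⟨rfl, h⟩
    rw [Fin.ext h]

theorem IsRooting.exists_iso_twoHub {V : Type*} [Fintype V] {G : SimpleGraph V}
    {par : V → Option V} {dep : V → ℕ} {u v : V} (h : IsRooting G par dep u) (hv : v ≠ u)
    (hdeg : ∀ x, x ≠ u → x ≠ v → deg G x ≤ 2) :
    let s : Finset V := {x | ¬ OnTrunk par v x ∧ (par x = some u ∨ par x = some v)}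
    ∃ γ : s → ℕ, (∀ i, 0 < γ i) ∧
      ∃ f : G ≃g twoHub (dep v) γ fun i => decide (par i = some u),
        f u = .inl 0 ∧ f v = .inl (Fin.last _) := by
  intro s
  obtain ⟨leg, pos, hlp⟩ := h.exists_leg (OnTrunk par v)
  have hpar : ∀ {x}, ¬ OnTrunk par v x → ∃ y, par x = some y := fun hx =>
    h.exists_par fun hr => hx (hr ▸ h.trunk_root)
  have hleg : ∀ x, ¬ OnTrunk par v x → leg x ∈ s := by
    intro x hx
    induction hn : dep x generalizing x with
    | zero => exact (hx (h.eq_root hn ▸ h.trunk_root)).elim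
    | succ n ih =>
      obtain ⟨y, hxy⟩ := hpar hx
      by_cases hy : OnTrunk par v y
      · rw [((hlp x y hxy).1 hy).1]
        refine mem_filter.2 ⟨mem_univ _, hx, ?_⟩
        rw [hxy, Option.some_inj, Option.some_inj]
        exact h.eq_root_or_eq_of_par_mem_trunk hdeg hx hy hxy
      · rw [((hlp x y hxy).2 hy).1]
        exact ih y hy (by have := h.dep_eq x y hxy; omega)
  have hs : ∀ i ∈ s, ¬ OnTrunk par v i ∧ leg i = i := by
    intro i hi
    obtain ⟨hi, hiu | hiv⟩ := (mem_filter.1 hi).2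
    · exact ⟨hi, ((hlp i u hiu).1 h.trunk_root).1⟩
    · exact ⟨hi, ((hlp i v hiv).1 .refl).1⟩
  let γ : s → ℕ := fun i => ({x | ¬ OnTrunk par v x ∧ leg x = i} : Finset V).sup (pos · + 1)
  have hpos : ∀ x (hx : ¬ OnTrunk par v x), pos x < γ ⟨leg x, hleg x hx⟩ := fun x hx =>
    le_sup (f := (pos · + 1)) (mem_filter.2 ⟨mem_univ x, hx, rfl⟩)
  let φ : V → Fin (dep v + 1) ⊕ (Σ i, Fin (γ i)) := fun x =>
    if hx : OnTrunk par v x then .inl ⟨dep x, Nat.lt_succ_of_le (h.trunk_dep_le hx)⟩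
    else .inr ⟨⟨leg x, hleg x hx⟩, ⟨pos x, hpos x hx⟩⟩
  have hφ1 : ∀ x (hx : OnTrunk par v x),
      φ x = .inl ⟨dep x, Nat.lt_succ_of_le (h.trunk_dep_le hx)⟩ := fun x hx => dif_pos hx
  have hφ2 : ∀ x (hx : ¬ OnTrunk par v x),
      φ x = .inr ⟨⟨leg x, hleg x hx⟩, ⟨pos x, hpos x hx⟩⟩ := fun x hx => dif_neg hx
  have hu : φ u = .inl 0 := by
    rw [hφ1 u h.trunk_root]
    exact congrArg Sum.inl (Fin.ext h.dep_root)
  have hv' : φ v = .inl (Fin.last _) := hφ1 v .refl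
  have hmap : ∀ x, twoHubPar (dep v) γ (fun i => decide (par i = some u)) (φ x) =
      (par x).map φ := by
    intro x
    by_cases hx : OnTrunk par v x
    · rw [hφ1 x hx]
      cases hp : par x with
      | none =>
        rw [h.root_iff] at hp
        subst hp
        simp [twoHubPar, h.dep_root]
      | some y =>
        have := h.dep_eq x y hp
        rw [Option.map_some, hφ1 y (hx.tail hp), twoHubPar, if_neg (by simp [this])]
        simp [this]
    · obtain ⟨y, hxy⟩ := hpar hx
      rw [hφ2 x hx, hxy, Option.map_some, twoHubPar, Option.some_inj]
      by_cases hy : OnTrunk par v y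
      · obtain ⟨h1, h2⟩ := (hlp x y hxy).1 hy
        rw [if_pos h2]
        simp only [h1, hxy, Option.some_inj, decide_eq_true_eq]
        rcases h.eq_root_or_eq_of_par_mem_trunk hdeg hx hy hxy with rfl | rfl
        · rw [if_pos rfl, hu]
        · rw [if_neg hv, hv']
      · obtain ⟨h1, h2⟩ := (hlp x y hxy).2 hy
        rw [if_neg (by simp [h2]), hφ2 y hy]
        refine congrArg Sum.inr (sigma_fin_eq_iff.2 ⟨Subtype.ext h1, ?_⟩)
        simp [h2]
  have hinj : Function.Injective φ := by
    refine h.injective_of_par_map hmap fun p x y hx hy hxy => ?_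
    by_cases hx' : OnTrunk par v x <;> by_cases hy' : OnTrunk par v y
    · exact h.trunk_dep_injOn hx' hy' (by
        rw [h.dep_eq x p hx, h.dep_eq y p hy])
    · simp [hφ1 x hx', hφ2 y hy'] at hxy
    · simp [hφ2 x hx', hφ1 y hy'] at hxy
    · by_cases hp : OnTrunk par v p
      · rw [hφ2 x hx', hφ2 y hy', Sum.inr.injEq, sigma_fin_eq_iff, Subtype.mk.injEq] at hxy
        exact ((hlp x p hx).1 hp).1.symm.trans (hxy.1.trans ((hlp y p hy).1 hp).1)
      · have hpu : p ≠ u := fun hpu => hp (hpu ▸ h.trunk_root)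
        exact h.eq_of_par_eq_of_deg_le_two hpu (hdeg p hpu fun hpv => hp (hpv ▸ .refl)) hx hy
  have hdown : ∀ x m, ¬ OnTrunk par v x → m ≤ pos x →
      ∃ y, ¬ OnTrunk par v y ∧ leg y = leg x ∧ pos y = m := by
    intro x m hx hm
    induction hn : pos x generalizing x with
    | zero => exact ⟨x, hx, rfl, by omega⟩
    | succ n ih =>
      rcases hm.eq_or_lt with rfl | hm
      · exact ⟨x, hx, rfl, rfl⟩
      obtain ⟨y, hxy⟩ := hpar hx
      have hy : ¬ OnTrunk par v y := fun hy => by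
        have := ((hlp x y hxy).1 hy).2
        omega
      obtain ⟨h1, h2⟩ := (hlp x y hxy).2 hy
      rw [h1]
      exact ih y hy (by omega) (by omega)
  have hsurj : Function.Surjective φ := by
    rintro (k | ⟨i, j⟩)
    · obtain ⟨x, hx, hk⟩ := h.exists_trunk_dep (v := v) (Nat.le_of_lt_succ k.2)
      exact ⟨x, by rw [hφ1 x hx]; exact congrArg Sum.inl (Fin.ext hk)⟩
    · obtain ⟨x, hx, hsup⟩ := exists_mem_eq_sup ({x | ¬ OnTrunk par v x ∧ leg x = i} : Finset V)
        ⟨i, mem_filter.2 ⟨mem_univ _, hs i i.2⟩⟩ (pos · + 1)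
      obtain ⟨hx, hxi⟩ := (mem_filter.1 hx).2
      have hj : j.1 < pos x + 1 := lt_of_lt_of_eq j.2 hsup
      obtain ⟨y, hy, hyx, hyj⟩ := hdown x j hx (by omega)
      refine ⟨y, ?_⟩
      rw [hφ2 y hy]
      exact congrArg Sum.inr (sigma_fin_eq_iff.2 ⟨Subtype.ext (hyx.trans hxi), hyj⟩)
  obtain ⟨f, hf⟩ := h.exists_iso (twoHub_isRooting _ _ _) (.ofBijective φ ⟨hinj, hsurj⟩) hmap
  refine ⟨γ, fun i => ?_, f, (hf u).trans hu, (hf v).trans hv'⟩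
  obtain ⟨h1, h2⟩ := hs i i.2
  have := hpos i h1
  simp only [h2] at this
  exact (Nat.zero_le _).trans_lt this

theorem exists_isProperTwoHub_iso {V : Type*} [Fintype V] {G : SimpleGraph V} (hG : G.IsTree)
    (h2 : #{x | 3 ≤ deg G x} = 2) :
    ∃ (s : Finset V) (d : ℕ) (γ : s → ℕ) (σ : s → Bool),
      IsProperTwoHub d γ σ ∧ Nonempty (G ≃g twoHub d γ σ) := by
  obtain ⟨u, v, huv, hset⟩ := card_eq_two.1 h2
  have hmem : ∀ x, 3 ≤ deg G x ↔ x = u ∨ x = v := by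
    intro x
    simpa using Finset.ext_iff.1 hset x
  have hdeg : ∀ x, x ≠ u → x ≠ v → deg G x ≤ 2 := by
    intro x hxu hxv
    have := (hmem x).not.2 (not_or.2 ⟨hxu, hxv⟩)
    omega
  obtain ⟨par, dep, h⟩ := exists_isRooting hG u
  obtain ⟨γ, hγ, f, hfu, hfv⟩ := h.exists_iso_twoHub huv.symm hdeg
  refine ⟨_, _, γ, _, ⟨?_, hγ, ?_, ?_, ?_⟩, ⟨f⟩⟩
  · exact Nat.pos_of_ne_zero fun h0 => huv (h.eq_root h0).symm
  · have hu := h.two_le_card_children ((hmem u).2 (.inl rfl)) (h.trunk_root (v := v)) (by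
      intro x y _ _ hx hy
      have key : ∀ z, G.Adj u z → dep z = dep u + 1 := fun z hz =>
        h.dep_eq _ _ (((h.adj_iff u z).1 hz).resolve_left (by simp [(h.root_iff u).2 rfl]))
      rw [key x hx, key y hy])
    refine hu.trans (le_of_eq_of_le ?_ (card_map (Function.Embedding.subtype _)).le)
    congr 1
    ext x
    simp
    tauto
  · have hv := h.two_le_card_children ((hmem v).2 (.inr rfl)) (.refl (a := v)) (by
      intro x y hx hy hvx hvy
      have key : ∀ z, OnTrunk par v z → G.Adj v z → dep v = dep z + 1 := by
        intro z hz hvz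
        refine h.dep_eq _ _ (((h.adj_iff v z).1 hvz).resolve_right fun hzv => ?_)
        have h1 := h.dep_eq _ _ hzv
        have h2 := h.trunk_dep_le hz
        omega
      have h1 := key x hx hvx
      have h2 := key y hy hvy
      omega)
    refine hv.trans (le_of_eq_of_le ?_ (card_map (Function.Embedding.subtype _)).le)
    congr 1
    ext x
    simp only [mem_filter, mem_univ, true_and, mem_map, Function.Embedding.subtype_apply,
      Subtype.exists, decide_eq_true_eq, exists_and_left, exists_prop, exists_eq_right_right]
    constructor
    · rintro ⟨hx, hp⟩
      exact ⟨by simp [hp, huv.symm], hx, .inr hp⟩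
    · rintro ⟨hne, hx, hp⟩
      exact ⟨hx, hp.resolve_left hne⟩
  · intro x hx0 hxd
    obtain ⟨y, rfl⟩ := f.surjective x
    rw [deg_map]
    refine hdeg y ?_ ?_
    · rintro rfl
      exact hx0 hfu
    · rintro rfl
      exact hxd hfv

end Recognition

/-- main theorem: a tree with exactly two vertices of degree at least 3
is determined by its chromatic symmetric function. -/
theorem stmt18 {V W : Type*} [Finite V] [Finite W] (T : SimpleGraph V)
    (hc : T.Connected) (ha : T.IsAcyclic)
    (h2 : Nat.card {v : V | 3 ≤ deg T v} = 2)
    (F : SimpleGraph W) (h : csf F = csf T) :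
    Nonempty (F ≃g T) := by
  classical
  cases nonempty_fintype V
  cases nonempty_fintype W
  have hT : T.IsTree := ⟨hc, ha⟩
  have hF := isTree_of_csf_eq hT h
  rw [Nat.card_eq_fintype_card, Fintype.card_subtype] at h2
  simp only [Set.mem_ofPred_eq] at h2
  obtain ⟨s, d, γ, σ, hσ, ⟨f⟩⟩ := exists_isProperTwoHub_iso hT (by convert h2)
  obtain ⟨s', d', γ', σ', hσ', ⟨f'⟩⟩ := exists_isProperTwoHub_iso hF (by
    rw [card_deg_eq hF hT h]
    convert h2)
  obtain ⟨g⟩ := twoHub_iso_of_subtreeSum_eq hσ' hσ (by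
    rw [← subtreeSum_map f, ← subtreeSum_map f', subtreeSum_eq hF hT h])
  exact ⟨f'.trans (g.trans f.symm)⟩
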